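/- Let G be a finite group, let n ∈ {1,…,|G|}, and let α be a partial action of G on a C*-algebra A with the n-decomposition property. Fix τ ∈ T_n(G). Then dim_Rok(α|_{H_τ}) = dim_Rok(α|_{A_{G·τ}}) and dim_Rok^c(α|_{H_τ}) = dim_Rok^c(α|_{A_{G·τ}}), where α|_{H_τ} is the (global) action of the subgroup H_τ on A_τ obtained by restricting α, and α|_{A_{G·τ}} is the restriction of α to the G-invariant ideal A_{G·τ}. Consequently, dim_Rok(α) = max_{τ ∈ T_n(G)} dim_Rok(α|_{H_τ}) and dim_Rok^c(α) = max_{τ ∈ T_n(G)} dim_Rok^c(α|_{H_τ}). -/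

import Mathlib

/-- A partial action of a (discrete) group `G` on a C*-algebra `A`: a family of closed
two-sided (star-closed) ideals `dom g ⊆ A` and *-isomorphisms
`act g : dom g⁻¹ → dom g` (encoded as total maps, with all axioms stated on the domains),
such that `dom 1 = A`, `act 1 = id`, `act g` maps `dom g⁻¹ ∩ dom h` into `dom g ∩ dom (g*h)`,
and `act (g*h)` extends `act g ∘ act h`. -/
structure CStarPartialAction (G : Type*) [Group G] (A : Type*) [NonUnitalCStarAlgebra A] where
  dom : G → Set A
  act : G → A → A
  dom_isClosed : ∀ g, IsClosed (dom g)
  zero_mem : ∀ g, (0 : A) ∈ dom g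
  add_mem : ∀ g, ∀ x ∈ dom g, ∀ y ∈ dom g, x + y ∈ dom g
  smul_mem : ∀ g (c : ℂ), ∀ x ∈ dom g, c • x ∈ dom g
  mul_mem_left : ∀ g (a : A), ∀ x ∈ dom g, a * x ∈ dom g
  mul_mem_right : ∀ g (a : A), ∀ x ∈ dom g, x * a ∈ dom g
  star_mem : ∀ g, ∀ x ∈ dom g, star x ∈ dom g
  dom_one : dom 1 = Set.univ
  act_one : ∀ x, act 1 x = x
  act_mem : ∀ g, ∀ x ∈ dom g⁻¹, act g x ∈ dom g
  act_add : ∀ g, ∀ x ∈ dom g⁻¹, ∀ y ∈ dom g⁻¹, act g (x + y) = act g x + act g y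
  act_smul : ∀ g (c : ℂ), ∀ x ∈ dom g⁻¹, act g (c • x) = c • act g x
  act_mul : ∀ g, ∀ x ∈ dom g⁻¹, ∀ y ∈ dom g⁻¹, act g (x * y) = act g x * act g y
  act_star : ∀ g, ∀ x ∈ dom g⁻¹, act g (star x) = star (act g x)
  act_inv_act : ∀ g, ∀ x ∈ dom g⁻¹, act g⁻¹ (act g x) = x
  act_surjOn : ∀ g, ∀ y ∈ dom g, ∃ x ∈ dom g⁻¹, act g x = y
  act_inter_mem : ∀ g h, ∀ x ∈ dom g⁻¹ ∩ dom h, act g x ∈ dom g ∩ dom (g * h)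
  act_comp : ∀ g h, ∀ x ∈ dom h⁻¹ ∩ dom (g * h)⁻¹, act (g * h) x = act g (act h x)

/-- A positive contraction in a C*-algebra. -/
def IsPosContraction {A : Type*} [NonUnitalCStarAlgebra A] (f : A) : Prop :=
  (∃ b, f = star b * b) ∧ ‖f‖ ≤ 1

variable {G : Type*} [Group G] [Fintype G] {A : Type*} [NonUnitalCStarAlgebra A]

/-- Conditions (1)–(4) of the definition of Rokhlin dimension, for the tolerance `ε` and
finite set `F`. -/
def RokhlinTowers (α : CStarPartialAction G A) (d : ℕ) (F : Finset A) (ε : ℝ)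
    (f : G → Fin (d + 1) → A) : Prop :=
  (∀ g j, f g j ∈ α.dom g ∧ IsPosContraction (f g j)) ∧
  (∀ g h j, ∀ a ∈ F, ∀ x ∈ F, x ∈ α.dom g⁻¹ →
    ‖(α.act g (f h j * x) - f (g * h) j * α.act g x) * a‖ < ε) ∧
  (∀ j, ∀ g h : G, g ≠ h → ∀ a ∈ F, ‖f g j * f h j * a‖ < ε) ∧
  (∀ a ∈ F, ‖(∑ j : Fin (d + 1), ∑ g : G, f g j) * a - a‖ < ε) ∧
  (∀ g j, ∀ a ∈ F, ∀ b ∈ F, ‖(f g j * b - b * f g j) * a‖ < ε)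

/-- Condition (5): approximately commuting towers. -/
def CommutingTowers (d : ℕ) (F : Finset A) (ε : ℝ) (f : G → Fin (d + 1) → A) : Prop :=
  ∀ g h : G, ∀ j k : Fin (d + 1), ∀ a ∈ F, ‖(f g j * f h k - f h k * f g j) * a‖ < ε

/-- `α` has Rokhlin dimension at most `d`. -/
def HasRokhlinDimLE (α : CStarPartialAction G A) (d : ℕ) : Prop :=
  ∀ ε > (0 : ℝ), ∀ F : Finset A, ∃ f : G → Fin (d + 1) → A, RokhlinTowers α d F ε f

/-- `α` has Rokhlin dimension with commuting towers at most `d`. -/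
def HasRokhlinDimCLE (α : CStarPartialAction G A) (d : ℕ) : Prop :=
  ∀ ε > (0 : ℝ), ∀ F : Finset A, ∃ f : G → Fin (d + 1) → A,
    RokhlinTowers α d F ε f ∧ CommutingTowers d F ε f

/-- The Rokhlin dimension of `α`, as an extended natural number. -/
noncomputable def rokhlinDim (α : CStarPartialAction G A) : ℕ∞ :=
  sInf {n : ℕ∞ | ∃ d : ℕ, n = d ∧ HasRokhlinDimLE α d}

/-- The Rokhlin dimension with commuting towers of `α`. -/
noncomputable def rokhlinDimC (α : CStarPartialAction G A) : ℕ∞ :=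
  sInf {n : ℕ∞ | ∃ d : ℕ, n = d ∧ HasRokhlinDimCLE α d}

open scoped Pointwise

section Stmt7

variable {G : Type*} [Group G] [Fintype G] [DecidableEq G]
variable {A : Type*} [NonUnitalCStarAlgebra A]

/-- `A_σ = ⋂_{g ∈ σ} A_g`. -/
def domInter (α : CStarPartialAction G A) (σ : Finset G) : Set A := ⋂ g ∈ σ, α.dom g

/-- The space `T_n(G)` of `n`-tuples of `G`: subsets of `G` of cardinality `n`
containing `1`. -/
def nTuples (G : Type*) [Group G] [Fintype G] [DecidableEq G] (n : ℕ) : Finset (Finset G) :=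
  Finset.univ.filter fun τ => (1 : G) ∈ τ ∧ τ.card = n

/-- The stabilizer `H_τ = {h ∈ G : hτ = τ}`. -/
def stab (τ : Finset G) : Finset G := Finset.univ.filter fun h => h • τ = τ

/-- The `G`-invariant ideal `A_{G·τ} = Σ_{g ∈ τ⁻¹} A_{gτ}`. -/
def orbitIdeal (α : CStarPartialAction G A) (τ : Finset G) : Set A :=
  {x | ∃ c : G → A, (∀ g ∈ τ⁻¹, c g ∈ domInter α (g • τ)) ∧ x = ∑ g ∈ τ⁻¹, c g}

/-- The `n`-decomposition property: `A` is the closure of `Σ_{τ ∈ T_n(G)} A_τ` and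
`A_τ ∩ A_g = 0` whenever `g ∉ τ`. -/
def NDecomposition (α : CStarPartialAction G A) (n : ℕ) : Prop :=
  Dense {x : A | ∃ c : Finset G → A,
      (∀ τ ∈ nTuples G n, c τ ∈ domInter α τ) ∧ x = ∑ τ ∈ nTuples G n, c τ} ∧
  ∀ τ ∈ nTuples G n, ∀ g ∉ τ, domInter α τ ∩ α.dom g ⊆ {0}

/-- Rokhlin towers for the (global) action of the subgroup `H_τ` on the ideal `A_τ`
obtained by restricting `α`. -/
def SubgroupRokhlinTowers (α : CStarPartialAction G A) (τ : Finset G) (d : ℕ)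
    (F : Finset A) (ε : ℝ) (f : G → Fin (d + 1) → A) : Prop :=
  (∀ h ∈ stab τ, ∀ j, f h j ∈ domInter α τ ∧ IsPosContraction (f h j)) ∧
  (∀ h ∈ stab τ, ∀ k ∈ stab τ, ∀ j, ∀ a ∈ F, ∀ x ∈ F,
    ‖(α.act h (f k j * x) - f (h * k) j * α.act h x) * a‖ < ε) ∧
  (∀ j, ∀ h ∈ stab τ, ∀ k ∈ stab τ, h ≠ k → ∀ a ∈ F, ‖f h j * f k j * a‖ < ε) ∧
  (∀ a ∈ F, ‖(∑ j : Fin (d + 1), ∑ h ∈ stab τ, f h j) * a - a‖ < ε) ∧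
  (∀ h ∈ stab τ, ∀ j, ∀ a ∈ F, ∀ b ∈ F, ‖(f h j * b - b * f h j) * a‖ < ε)

/-- `dim_Rok(α|_{H_τ}) ≤ d` for the restricted global system `H_τ ↷ A_τ`. -/
def HasSubgroupRokhlinDimLE (α : CStarPartialAction G A) (τ : Finset G) (d : ℕ) : Prop :=
  ∀ ε > (0 : ℝ), ∀ F : Finset A, ↑F ⊆ domInter α τ →
    ∃ f : G → Fin (d + 1) → A, SubgroupRokhlinTowers α τ d F ε f

/-- `dim_Rok^c(α|_{H_τ}) ≤ d` for the restricted global system `H_τ ↷ A_τ`. -/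
def HasSubgroupRokhlinDimCLE (α : CStarPartialAction G A) (τ : Finset G) (d : ℕ) : Prop :=
  ∀ ε > (0 : ℝ), ∀ F : Finset A, ↑F ⊆ domInter α τ →
    ∃ f : G → Fin (d + 1) → A, SubgroupRokhlinTowers α τ d F ε f ∧
      ∀ h ∈ stab τ, ∀ h' ∈ stab τ, ∀ j k : Fin (d + 1), ∀ a ∈ F,
        ‖(f h j * f h' k - f h' k * f h j) * a‖ < ε

/-- The Rokhlin dimension of `α|_{H_τ}`. -/
noncomputable def subgroupRokhlinDim (α : CStarPartialAction G A) (τ : Finset G) : ℕ∞ :=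
  sInf {m : ℕ∞ | ∃ d : ℕ, m = d ∧ HasSubgroupRokhlinDimLE α τ d}

/-- The Rokhlin dimension with commuting towers of `α|_{H_τ}`. -/
noncomputable def subgroupRokhlinDimC (α : CStarPartialAction G A) (τ : Finset G) : ℕ∞ :=
  sInf {m : ℕ∞ | ∃ d : ℕ, m = d ∧ HasSubgroupRokhlinDimCLE α τ d}

/-- `dim_Rok(α|_I) ≤ d` for the restriction of `α` to a `G`-invariant ideal `I`. -/
def HasIdealRokhlinDimLE (α : CStarPartialAction G A) (I : Set A) (d : ℕ) : Prop :=
  ∀ ε > (0 : ℝ), ∀ F : Finset A, ↑F ⊆ I →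
    ∃ f : G → Fin (d + 1) → A, RokhlinTowers α d F ε f ∧ ∀ g j, f g j ∈ I

/-- `dim_Rok^c(α|_I) ≤ d` for the restriction of `α` to a `G`-invariant ideal `I`. -/
def HasIdealRokhlinDimCLE (α : CStarPartialAction G A) (I : Set A) (d : ℕ) : Prop :=
  ∀ ε > (0 : ℝ), ∀ F : Finset A, ↑F ⊆ I →
    ∃ f : G → Fin (d + 1) → A, (RokhlinTowers α d F ε f ∧ CommutingTowers d F ε f) ∧
      ∀ g j, f g j ∈ I

/-- The Rokhlin dimension of `α|_I`. -/
noncomputable def idealRokhlinDim (α : CStarPartialAction G A) (I : Set A) : ℕ∞ :=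
  sInf {m : ℕ∞ | ∃ d : ℕ, m = d ∧ HasIdealRokhlinDimLE α I d}

/-- The Rokhlin dimension with commuting towers of `α|_I`. -/
noncomputable def idealRokhlinDimC (α : CStarPartialAction G A) (I : Set A) : ℕ∞ :=
  sInf {m : ℕ∞ | ∃ d : ℕ, m = d ∧ HasIdealRokhlinDimCLE α I d}

section CStarPreliminaries

variable {A : Type*} [NonUnitalCStarAlgebra A]

lemma exists_sum_eq_star_mul_self {ι : Type*} (S : Finset ι) (f : ι → A)
    (hf : ∀ i ∈ S, ∃ b, f i = star b * b) : ∃ b, ∑ i ∈ S, f i = star b * b := by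
  let _ := CStarAlgebra.spectralOrder A
  have := CStarAlgebra.spectralOrderedRing A
  rw [← CStarAlgebra.nonneg_iff_eq_star_mul_self]
  refine Finset.sum_nonneg fun i hi => ?_
  rw [CStarAlgebra.nonneg_iff_eq_star_mul_self]
  exact hf i hi

lemma exists_smul_eq_star_mul_self {f : A} (hf : ∃ b, f = star b * b) {r : ℝ} (hr : 0 ≤ r) :
    ∃ b, r • f = star b * b := by
  let _ := CStarAlgebra.spectralOrder A
  have := CStarAlgebra.spectralOrderedRing A
  rw [← CStarAlgebra.nonneg_iff_eq_star_mul_self] at hf ⊢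
  exact smul_nonneg hr hf

lemma IsPosContraction.zero : IsPosContraction (0 : A) := ⟨⟨0, by simp⟩, by simp⟩

lemma IsPosContraction.star_eq {f : A} (hf : IsPosContraction f) : star f = f := by
  obtain ⟨⟨b, rfl⟩, -⟩ := hf
  simp

lemma IsPosContraction.map {B : Type*} [NonUnitalCStarAlgebra B] (φ : A →⋆ₙₐ[ℂ] B) {f : A}
    (hf : IsPosContraction f) : IsPosContraction (φ f) := by
  obtain ⟨⟨b, hb⟩, h1⟩ := hf
  exact ⟨⟨φ b, by rw [hb, map_mul, map_star]⟩, (NonUnitalStarAlgHom.norm_apply_le φ f).trans h1⟩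

lemma IsPosContraction.conj {e f : A} (he : IsPosContraction e) (hf : IsPosContraction f) :
    IsPosContraction (e * f * e) := by
  refine ⟨?_, ?_⟩
  · obtain ⟨⟨b, rfl⟩, -⟩ := hf
    exact ⟨b * e, by rw [star_mul, he.star_eq]; simp only [mul_assoc]⟩
  · have h1 := he.2
    have h2 := hf.2
    calc ‖e * f * e‖ ≤ ‖e‖ * ‖f‖ * ‖e‖ :=
          (norm_mul_le _ _).trans (mul_le_mul_of_nonneg_right (norm_mul_le _ _) (norm_nonneg _))
      _ ≤ 1 * 1 * 1 := by gcongr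
      _ = 1 := by norm_num

/-- The norm of a sum of almost orthogonal positive contractions is almost at most one. -/
lemma norm_sum_sq_le {ι : Type*} [DecidableEq ι] (S : Finset ι) (w : ι → A)
    (hw : ∀ i ∈ S, IsPosContraction (w i)) :
    ‖∑ i ∈ S, w i‖ ^ 2 ≤ ‖∑ i ∈ S, w i‖ + ∑ i ∈ S, ∑ j ∈ S.erase i, ‖w i * w j‖ := by
  let _ := CStarAlgebra.spectralOrder A
  have := CStarAlgebra.spectralOrderedRing A
  have hsa : star (∑ i ∈ S, w i) = ∑ i ∈ S, w i := by
    rw [star_sum]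
    exact Finset.sum_congr rfl fun i hi => (hw i hi).star_eq
  have hsq : ∀ i ∈ S, 0 ≤ w i * w i ∧ w i * w i ≤ w i := by
    intro i hi
    obtain ⟨⟨b, hb⟩, h1⟩ := hw i hi
    have hnn : 0 ≤ w i := CStarAlgebra.nonneg_iff_eq_star_mul_self.2 ⟨b, hb⟩
    refine ⟨?_, ?_⟩
    · rw [CStarAlgebra.nonneg_iff_eq_star_mul_self]
      exact ⟨w i, by rw [(hw i hi).star_eq]⟩
    · have hc : star b * (b * star b) * b ≤ ‖b * star b‖ • (star b * b) :=
        CStarAlgebra.star_left_conjugate_le_norm_smul (IsSelfAdjoint.mul_star_self b)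
      have hn : ‖b * star b‖ ≤ 1 := by
        rw [CStarRing.norm_self_mul_star, ← CStarRing.norm_star_mul_self, ← hb]
        exact h1
      calc w i * w i = star b * (b * star b) * b := by rw [hb]; simp only [mul_assoc]
        _ ≤ ‖b * star b‖ • (star b * b) := hc
        _ = ‖b * star b‖ • w i := by rw [hb]
        _ ≤ (1 : ℝ) • w i := smul_le_smul_of_nonneg_right hn hnn
        _ = w i := one_smul _ _
  have hdiag : ‖∑ i ∈ S, w i * w i‖ ≤ ‖∑ i ∈ S, w i‖ :=
    CStarAlgebra.norm_le_norm_of_nonneg_of_le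
      (Finset.sum_nonneg fun i hi => (hsq i hi).1) (Finset.sum_le_sum fun i hi => (hsq i hi).2)
  have hexp : (∑ i ∈ S, w i) * (∑ i ∈ S, w i) =
      ∑ i ∈ S, w i * w i + ∑ i ∈ S, ∑ j ∈ S.erase i, w i * w j := by
    rw [Finset.sum_mul_sum, ← Finset.sum_add_distrib]
    refine Finset.sum_congr rfl fun i hi => ?_
    rw [Finset.add_sum_erase S (fun j => w i * w j) hi]
  calc ‖∑ i ∈ S, w i‖ ^ 2 = ‖(∑ i ∈ S, w i) * (∑ i ∈ S, w i)‖ := by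
        nth_rewrite 2 [← hsa]
        rw [CStarRing.norm_star_mul_self, sq]
    _ ≤ ‖∑ i ∈ S, w i * w i‖ + ‖∑ i ∈ S, ∑ j ∈ S.erase i, w i * w j‖ := by
        rw [hexp]
        exact norm_add_le _ _
    _ ≤ _ := by
        refine add_le_add hdiag ((norm_sum_le _ _).trans (Finset.sum_le_sum fun i _ => ?_))
        exact norm_sum_le _ _

lemma exists_approx_unit (F : Finset A) {δ : ℝ} (hδ : 0 < δ) :
    ∃ e : A, IsPosContraction e ∧ ∀ y ∈ F, ‖e * y - y‖ < δ := by
  let _ := CStarAlgebra.spectralOrder A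
  have := CStarAlgebra.spectralOrderedRing A
  have hu := CStarAlgebra.increasingApproximateUnit A
  have := hu.neBot
  have h1 : ∀ᶠ e in CStarAlgebra.approximateUnit A, ∀ y ∈ F, ‖e * y - y‖ < δ := by
    rw [Filter.eventually_all_finset]
    intro y _
    have := (hu.tendsto_mul_right y).eventually (Metric.ball_mem_nhds y hδ)
    filter_upwards [this] with e he
    exact mem_ball_iff_norm.1 he
  obtain ⟨e, ⟨he1, he2⟩, he3⟩ :=
    ((hu.eventually_nonneg.and hu.eventually_norm).and h1).exists
  exact ⟨e, ⟨CStarAlgebra.nonneg_iff_eq_star_mul_self.1 he1, he2⟩, he3⟩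

end CStarPreliminaries

section Decomposition

set_option linter.unusedSectionVars false

variable {G : Type*} [Group G] [Fintype G] [DecidableEq G] {A : Type*} [NonUnitalCStarAlgebra A]
variable {α : CStarPartialAction G A} {n : ℕ} {σ τ : Finset G} {x y : A}

lemma mem_domInter : x ∈ domInter α σ ↔ ∀ g ∈ σ, x ∈ α.dom g := by
  simp [domInter]

lemma isClosed_domInter (σ : Finset G) : IsClosed (domInter α σ) :=
  isClosed_biInter fun g _ => α.dom_isClosed g

lemma domInter_zero (σ : Finset G) : (0 : A) ∈ domInter α σ :=
  mem_domInter.2 fun g _ => α.zero_mem g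

lemma domInter_add (hx : x ∈ domInter α σ) (hy : y ∈ domInter α σ) : x + y ∈ domInter α σ :=
  mem_domInter.2 fun g hg => α.add_mem g _ (mem_domInter.1 hx g hg) _ (mem_domInter.1 hy g hg)

lemma domInter_smul (c : ℂ) (hx : x ∈ domInter α σ) : c • x ∈ domInter α σ :=
  mem_domInter.2 fun g hg => α.smul_mem g c _ (mem_domInter.1 hx g hg)

lemma domInter_sub (hx : x ∈ domInter α σ) (hy : y ∈ domInter α σ) : x - y ∈ domInter α σ := by
  have := domInter_add hx (domInter_smul (-1 : ℂ) hy)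
  simpa [sub_eq_add_neg] using this

lemma domInter_mul_left (a : A) (hx : x ∈ domInter α σ) : a * x ∈ domInter α σ :=
  mem_domInter.2 fun g hg => α.mul_mem_left g a _ (mem_domInter.1 hx g hg)

lemma domInter_mul_right (a : A) (hx : x ∈ domInter α σ) : x * a ∈ domInter α σ :=
  mem_domInter.2 fun g hg => α.mul_mem_right g a _ (mem_domInter.1 hx g hg)

lemma domInter_star (hx : x ∈ domInter α σ) : star x ∈ domInter α σ :=
  mem_domInter.2 fun g hg => α.star_mem g _ (mem_domInter.1 hx g hg)

lemma domInter_sum {ι : Type*} (S : Finset ι) (f : ι → A) (hf : ∀ i ∈ S, f i ∈ domInter α σ) :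
    ∑ i ∈ S, f i ∈ domInter α σ :=
  Finset.sum_induction f (· ∈ domInter α σ) (fun _ _ => domInter_add) (domInter_zero σ) hf

lemma CStarPartialAction.dom_sum (α : CStarPartialAction G A) (g : G) {ι : Type*} (S : Finset ι)
    (f : ι → A) (hf : ∀ i ∈ S, f i ∈ α.dom g) : ∑ i ∈ S, f i ∈ α.dom g :=
  Finset.sum_induction f (· ∈ α.dom g) (fun _ _ hx hy => α.add_mem g _ hx _ hy) (α.zero_mem g) hf

lemma CStarPartialAction.act_zero (α : CStarPartialAction G A) (g : G) : α.act g 0 = 0 := by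
  have := α.act_smul g 0 0 (α.zero_mem _)
  simpa using this

lemma CStarPartialAction.act_sum (α : CStarPartialAction G A) (g : G) {ι : Type*} (S : Finset ι)
    (f : ι → A) (hf : ∀ i ∈ S, f i ∈ α.dom g⁻¹) :
    α.act g (∑ i ∈ S, f i) = ∑ i ∈ S, α.act g (f i) := by
  classical
  induction S using Finset.induction_on with
  | empty => simp [α.act_zero]
  | insert i S hi ih =>
    have hS : ∀ j ∈ S, f j ∈ α.dom g⁻¹ := fun j hj => hf j (Finset.mem_insert_of_mem hj)
    rw [Finset.sum_insert hi, Finset.sum_insert hi,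
      α.act_add g _ (hf i (Finset.mem_insert_self i S)) _ (α.dom_sum _ S f hS), ih hS]

lemma mem_nTuples : σ ∈ nTuples G n ↔ 1 ∈ σ ∧ σ.card = n := by
  simp [nTuples]

lemma smul_mem_nTuples {g : G} (hσ : σ ∈ nTuples G n) (hg : g⁻¹ ∈ σ) : g • σ ∈ nTuples G n := by
  rw [mem_nTuples] at hσ ⊢
  exact ⟨Finset.mem_smul_finset.2 ⟨g⁻¹, hg, by simp⟩, by rw [Finset.card_smul_finset]; exact hσ.2⟩

lemma domInter_subset_dom {g : G} (hg : g ∈ σ) (hx : x ∈ domInter α σ) : x ∈ α.dom g :=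
  mem_domInter.1 hx g hg

lemma act_mem_domInter {g : G} (hg : g⁻¹ ∈ σ) (hx : x ∈ domInter α σ) :
    α.act g x ∈ domInter α (g • σ) := by
  refine mem_domInter.2 fun k hk => ?_
  obtain ⟨m, hm, rfl⟩ := Finset.mem_smul_finset.1 hk
  exact (α.act_inter_mem g m x ⟨domInter_subset_dom hg hx, domInter_subset_dom hm hx⟩).2

lemma eq_zero_of_mem_dom (hdec : NDecomposition α n) {g : G} (hσ : σ ∈ nTuples G n) (hg : g ∉ σ)
    (hx : x ∈ domInter α σ) (hx' : x ∈ α.dom g) : x = 0 :=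
  hdec.2 σ hσ g hg ⟨hx, hx'⟩

lemma domInter_mul_eq_zero (hdec : NDecomposition α n) (hσ : σ ∈ nTuples G n)
    (hτ : τ ∈ nTuples G n) (h : σ ≠ τ) (hx : x ∈ domInter α σ) (hy : y ∈ domInter α τ) :
    x * y = 0 := by
  obtain ⟨g, hgτ, hgσ⟩ : ∃ g ∈ τ, g ∉ σ := by
    by_contra! hc
    exact h (Finset.eq_of_subset_of_card_le hc
      (by rw [(mem_nTuples.1 hσ).2, (mem_nTuples.1 hτ).2])).symm
  exact eq_zero_of_mem_dom hdec hσ hgσ (domInter_mul_right y hx)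
    (α.mul_mem_left g x y (domInter_subset_dom hgτ hy))

lemma mul_sum_of_mem_domInter (hdec : NDecomposition α n) {c : Finset G → A}
    (hc : ∀ τ ∈ nTuples G n, c τ ∈ domInter α τ) (hσ : σ ∈ nTuples G n)
    (hx : x ∈ domInter α σ) : x * ∑ τ ∈ nTuples G n, c τ = x * c σ := by
  rw [Finset.mul_sum, Finset.sum_eq_single_of_mem σ hσ]
  intro τ hτ hne
  exact domInter_mul_eq_zero hdec hσ hτ hne.symm hx (hc τ hτ)

lemma norm_le_norm_sum (hdec : NDecomposition α n) {c : Finset G → A}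
    (hc : ∀ τ ∈ nTuples G n, c τ ∈ domInter α τ) (hσ : σ ∈ nTuples G n) :
    ‖c σ‖ ≤ ‖∑ τ ∈ nTuples G n, c τ‖ := by
  have h1 := mul_sum_of_mem_domInter hdec hc hσ (domInter_star (hc σ hσ))
  have h2 : ‖c σ‖ * ‖c σ‖ ≤ ‖c σ‖ * ‖∑ τ ∈ nTuples G n, c τ‖ := by
    rw [← CStarRing.norm_star_mul_self, ← h1]
    simpa using norm_mul_le (star (c σ)) (∑ τ ∈ nTuples G n, c τ)
  rcases (norm_nonneg (c σ)).eq_or_lt with h | h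
  · rw [← h]
    exact norm_nonneg _
  · exact le_of_mul_le_mul_left h2 h

lemma exists_decomposition (hdec : NDecomposition α n) (x : A) :
    ∃ c : Finset G → A, (∀ τ ∈ nTuples G n, c τ ∈ domInter α τ) ∧
      x = ∑ τ ∈ nTuples G n, c τ := by
  obtain ⟨u, hu, hux⟩ := mem_closure_iff_seq_limit.1 (hdec.1 x)
  choose c hc hcu using hu
  have hcauchy : ∀ σ ∈ nTuples G n, ∃ y, Filter.Tendsto (fun k => c k σ) Filter.atTop (nhds y) := by
    intro σ hσ
    refine cauchySeq_tendsto_of_complete ?_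
    rw [Metric.cauchySeq_iff]
    intro ε hε
    obtain ⟨N, hN⟩ := Metric.cauchySeq_iff.1 hux.cauchySeq ε hε
    refine ⟨N, fun k hk l hl => lt_of_le_of_lt ?_ (hN k hk l hl)⟩
    rw [dist_eq_norm, dist_eq_norm, hcu k, hcu l, ← Finset.sum_sub_distrib]
    exact norm_le_norm_sum hdec (c := fun τ => c k τ - c l τ)
      (fun τ hτ => domInter_sub (hc k τ hτ) (hc l τ hτ)) hσ
  choose! y hy using hcauchy
  refine ⟨y, fun τ hτ => (isClosed_domInter τ).mem_of_tendsto (hy τ hτ)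
    (Filter.Eventually.of_forall fun k => hc k τ hτ), ?_⟩
  refine tendsto_nhds_unique hux ?_
  rw [show u = _ from funext hcu]
  exact tendsto_finsetSum _ fun τ hτ => hy τ hτ

/-- The component of `x` in `A_σ`. -/
noncomputable def compFun (hdec : NDecomposition α n) (σ : Finset G) (x : A) : A :=
  if σ ∈ nTuples G n then (exists_decomposition hdec x).choose σ else 0

lemma compFun_mem (hdec : NDecomposition α n) (σ : Finset G) (x : A) :
    compFun hdec σ x ∈ domInter α σ := by
  unfold compFun
  split_ifs with h
  · exact (exists_decomposition hdec x).choose_spec.1 σ h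
  · exact domInter_zero σ

lemma sum_compFun (hdec : NDecomposition α n) (x : A) :
    ∑ σ ∈ nTuples G n, compFun hdec σ x = x := by
  refine Eq.trans (Finset.sum_congr rfl fun σ hσ => ?_)
    (exists_decomposition hdec x).choose_spec.2.symm
  exact if_pos hσ

lemma compFun_eq (hdec : NDecomposition α n) {c : Finset G → A}
    (hc : ∀ τ ∈ nTuples G n, c τ ∈ domInter α τ) (hx : x = ∑ τ ∈ nTuples G n, c τ)
    (σ : Finset G) : compFun hdec σ x = if σ ∈ nTuples G n then c σ else 0 := by
  split_ifs with hσ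
  · have h := norm_le_norm_sum hdec (c := fun τ => compFun hdec τ x - c τ)
      (fun τ hτ => domInter_sub (compFun_mem hdec τ x) (hc τ hτ)) hσ
    rw [Finset.sum_sub_distrib, sum_compFun, ← hx, sub_self, norm_zero] at h
    exact sub_eq_zero.1 (norm_le_zero_iff.1 h)
  · exact if_neg hσ

lemma compFun_of_notMem (hdec : NDecomposition α n) (hσ : σ ∉ nTuples G n) (x : A) :
    compFun hdec σ x = 0 := if_neg hσ

/-- The projection of `A` onto `A_σ`, as a star homomorphism. -/
noncomputable def compHom (hdec : NDecomposition α n) (σ : Finset G) : A →⋆ₙₐ[ℂ] A where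
  toFun := compFun hdec σ
  map_smul' c x := by
    rw [compFun_eq hdec (x := c • x) (c := fun τ => c • compFun hdec τ x)
      (fun τ _ => domInter_smul c (compFun_mem hdec τ x))
      (by rw [← Finset.smul_sum, sum_compFun])]
    split_ifs with h
    · rfl
    · rw [compFun_of_notMem hdec h]; simp
  map_zero' := by
    rw [compFun_eq hdec (x := 0) (c := fun _ => 0) (fun τ _ => domInter_zero τ) (by simp)]
    simp
  map_add' x y := by
    rw [compFun_eq hdec (x := x + y) (c := fun τ => compFun hdec τ x + compFun hdec τ y)
      (fun τ _ => domInter_add (compFun_mem hdec τ x) (compFun_mem hdec τ y))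
      (by rw [Finset.sum_add_distrib, sum_compFun, sum_compFun])]
    split_ifs with h
    · rfl
    · rw [compFun_of_notMem hdec h, compFun_of_notMem hdec h]; simp
  map_mul' x y := by
    rw [compFun_eq hdec (x := x * y) (c := fun τ => compFun hdec τ x * compFun hdec τ y)
      (fun τ _ => domInter_mul_left _ (compFun_mem hdec τ y)) ?_]
    · split_ifs with h
      · rfl
      · rw [compFun_of_notMem hdec h, compFun_of_notMem hdec h]; simp
    · conv_lhs => rw [← sum_compFun hdec x, Finset.sum_mul, ← sum_compFun hdec y]
      refine Finset.sum_congr rfl fun σ hσ => ?_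
      exact mul_sum_of_mem_domInter hdec (fun τ _ => compFun_mem hdec τ y) hσ
        (compFun_mem hdec σ x)
  map_star' x := by
    rw [compFun_eq hdec (x := star x) (c := fun τ => star (compFun hdec τ x))
      (fun τ _ => domInter_star (compFun_mem hdec τ x))
      (by rw [← star_sum, sum_compFun])]
    split_ifs with h
    · rfl
    · rw [compFun_of_notMem hdec h]; simp

lemma compHom_mem (hdec : NDecomposition α n) (σ : Finset G) (x : A) :
    compHom hdec σ x ∈ domInter α σ := compFun_mem hdec σ x

lemma sum_compHom (hdec : NDecomposition α n) (x : A) :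
    ∑ σ ∈ nTuples G n, compHom hdec σ x = x := sum_compFun hdec x

lemma compHom_sum (hdec : NDecomposition α n) {c : Finset G → A}
    (hc : ∀ τ ∈ nTuples G n, c τ ∈ domInter α τ) (hσ : σ ∈ nTuples G n) :
    compHom hdec σ (∑ τ ∈ nTuples G n, c τ) = c σ :=
  (compFun_eq hdec hc rfl σ).trans (if_pos hσ)

lemma compHom_of_mem (hdec : NDecomposition α n) (hσ : σ ∈ nTuples G n)
    (hx : x ∈ domInter α σ) : compHom hdec σ x = x := by
  have := compHom_sum hdec (c := fun τ => if τ = σ then x else 0) (σ := σ) (fun τ _ => by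
    split_ifs with h
    · rwa [h]
    · exact domInter_zero τ) hσ
  rwa [Finset.sum_ite_eq' (nTuples G n) σ, if_pos hσ, if_pos rfl] at this

lemma mul_of_mem_domInter (hdec : NDecomposition α n) (hσ : σ ∈ nTuples G n) (y : A)
    (hx : x ∈ domInter α σ) : y * x = compHom hdec σ y * x := by
  rw [← compHom_of_mem hdec hσ (domInter_mul_left y hx), map_mul, compHom_of_mem hdec hσ hx]

lemma compHom_eq_zero_of_mem_dom (hdec : NDecomposition α n) {g : G} (hσ : σ ∈ nTuples G n)
    (hg : g ∉ σ) (hx : x ∈ α.dom g) : compHom hdec σ x = 0 := by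
  have h := mul_of_mem_domInter hdec hσ x (compHom_mem hdec σ (star x))
  rw [← CStarRing.mul_star_self_eq_zero_iff, ← map_star, ← h]
  exact eq_zero_of_mem_dom hdec hσ hg (domInter_mul_left _ (compHom_mem hdec σ _))
    (α.mul_mem_right g _ _ hx)

lemma mem_dom_compHom (hdec : NDecomposition α n) {g : G} (hσ : σ ∈ nTuples G n)
    (hx : x ∈ α.dom g) : compHom hdec σ x ∈ α.dom g := by
  by_cases hg : g ∈ σ
  · exact domInter_subset_dom hg (compHom_mem hdec σ x)
  · rw [compHom_eq_zero_of_mem_dom hdec hσ hg hx]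
    exact α.zero_mem g

lemma compHom_ne (hdec : NDecomposition α n) (hσ : σ ∈ nTuples G n) (hτ : τ ∈ nTuples G n)
    (h : σ ≠ τ) (hx : x ∈ domInter α τ) : compHom hdec σ x = 0 := by
  rw [← CStarRing.mul_star_self_eq_zero_iff, ← map_star,
    ← mul_of_mem_domInter hdec hσ x (compHom_mem hdec σ (star x))]
  exact domInter_mul_eq_zero hdec hτ hσ h.symm hx (compHom_mem hdec σ _)

lemma norm_eq_pi_norm (hdec : NDecomposition α n) (x : A) :
    ‖x‖ = ‖fun σ : nTuples G n => compHom hdec σ x‖ := by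
  let φ : A →⋆ₙₐ[ℂ] (nTuples G n → A) :=
    { toFun := fun x σ => compHom hdec σ x
      map_smul' := fun c x => by ext; simp
      map_zero' := by ext; simp
      map_add' := fun x y => by ext; simp
      map_mul' := fun x y => by ext; simp
      map_star' := fun x => by ext; simp [map_star] }
  have hφ : Function.Injective φ := by
    intro x y hxy
    rw [← sum_compHom hdec x, ← sum_compHom hdec y]
    exact Finset.sum_congr rfl fun σ hσ => congrFun hxy ⟨σ, hσ⟩
  exact (NonUnitalStarAlgHom.norm_map φ hφ x).symm

lemma norm_lt_of_comp (hdec : NDecomposition α n) {ε : ℝ} (hε : 0 < ε)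
    (h : ∀ σ ∈ nTuples G n, ‖compHom hdec σ x‖ < ε) : ‖x‖ < ε := by
  rw [norm_eq_pi_norm hdec, pi_norm_lt_iff hε]
  exact fun σ => h σ σ.2

lemma norm_le_of_comp (hdec : NDecomposition α n) {r : ℝ} (hr : 0 ≤ r)
    (h : ∀ σ ∈ nTuples G n, ‖compHom hdec σ x‖ ≤ r) : ‖x‖ ≤ r := by
  rw [norm_eq_pi_norm hdec, pi_norm_le_iff_of_nonneg hr]
  exact fun σ => h σ σ.2

/-- The action of `g` on the summand `A_σ`, extended by zero to a star homomorphism of `A`. -/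
noncomputable def actHom (hdec : NDecomposition α n) (g : G) (σ : Finset G) (hg : g⁻¹ ∈ σ) :
    A →⋆ₙₐ[ℂ] A where
  toFun x := α.act g (compHom hdec σ x)
  map_smul' c x := by
    rw [map_smul, α.act_smul g c _ (domInter_subset_dom hg (compHom_mem hdec σ x))]
    rfl
  map_zero' := by rw [map_zero, α.act_zero]
  map_add' x y := by
    rw [map_add, α.act_add g _ (domInter_subset_dom hg (compHom_mem hdec σ x)) _
      (domInter_subset_dom hg (compHom_mem hdec σ y))]
  map_mul' x y := by
    rw [map_mul, α.act_mul g _ (domInter_subset_dom hg (compHom_mem hdec σ x)) _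
      (domInter_subset_dom hg (compHom_mem hdec σ y))]
  map_star' x := by
    rw [map_star, α.act_star g _ (domInter_subset_dom hg (compHom_mem hdec σ x))]

lemma actHom_of_mem (hdec : NDecomposition α n) {g : G} (hσ : σ ∈ nTuples G n) (hg : g⁻¹ ∈ σ)
    (hx : x ∈ domInter α σ) : actHom hdec g σ hg x = α.act g x := by
  change α.act g (compHom hdec σ x) = _
  rw [compHom_of_mem hdec hσ hx]

/-- The partial action permutes the components. -/
lemma compHom_act (hdec : NDecomposition α n) {g : G} (hσ : σ ∈ nTuples G n) (hg : g⁻¹ ∈ σ)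
    (hx : x ∈ α.dom g⁻¹) :
    compHom hdec (g • σ) (α.act g x) = α.act g (compHom hdec σ x) := by
  conv_lhs => rw [← sum_compHom hdec x,
    α.act_sum g _ _ (fun τ hτ => mem_dom_compHom hdec hτ hx), map_sum]
  rw [Finset.sum_eq_single_of_mem σ hσ]
  · exact compHom_of_mem hdec (smul_mem_nTuples hσ hg) (act_mem_domInter hg (compHom_mem hdec σ x))
  · intro τ hτ hne
    by_cases hgτ : g⁻¹ ∈ τ
    · exact compHom_ne hdec (smul_mem_nTuples hσ hg) (smul_mem_nTuples hτ hgτ)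
        (fun h => hne (smul_left_cancel g h).symm)
        (act_mem_domInter hgτ (compHom_mem hdec τ x))
    · rw [compHom_eq_zero_of_mem_dom hdec hτ hgτ hx, α.act_zero, map_zero]

lemma mem_stab {h : G} : h ∈ stab τ ↔ h • τ = τ := by simp [stab]

lemma mul_mem_stab {h k : G} (hh : h ∈ stab τ) (hk : k ∈ stab τ) : h * k ∈ stab τ := by
  rw [mem_stab] at *
  rw [mul_smul, hk, hh]

lemma inv_mem_stab {h : G} (hh : h ∈ stab τ) : h⁻¹ ∈ stab τ := by
  rw [mem_stab] at *
  rw [inv_smul_eq_iff, hh]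

lemma mul_mem_iff_of_mem_stab {h g : G} (hh : h ∈ stab τ) : h * g ∈ τ ↔ g ∈ τ := by
  rw [mem_stab] at hh
  conv_lhs => rw [← hh]
  rw [← smul_eq_mul, Finset.smul_mem_smul_finset_iff]

lemma mem_of_mem_stab (hτ : τ ∈ nTuples G n) {h : G} (hh : h ∈ stab τ) : h ∈ τ := by
  have := (mul_mem_iff_of_mem_stab (g := 1) hh).2 (mem_nTuples.1 hτ).1
  rwa [mul_one] at this

lemma act_mem_domInter_of_stab (hτ : τ ∈ nTuples G n) {h : G} (hh : h ∈ stab τ)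
    (hx : x ∈ domInter α τ) : α.act h x ∈ domInter α τ := by
  have := act_mem_domInter (mem_of_mem_stab hτ (inv_mem_stab hh)) hx
  rwa [mem_stab.1 hh] at this

end Decomposition

section Restriction

set_option linter.unusedSectionVars false

variable {G : Type*} [Group G] [Fintype G] [DecidableEq G] {A : Type*} [NonUnitalCStarAlgebra A]
variable {α : CStarPartialAction G A} {n : ℕ}

open Filter Topology

lemma tendsto_zero_of_norm_lt {w : ℕ → A} (h : ∀ k : ℕ, ‖w k‖ < 1 / ((k : ℝ) + 1)) :
    Tendsto w atTop (𝓝 0) :=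
  squeeze_zero_norm (fun k => (h k).le) tendsto_one_div_add_atTop_nhds_zero_nat

lemma Filter.Tendsto.contraction_mul {b w : ℕ → A} (hw : Tendsto w atTop (𝓝 0))
    (hb : ∀ k, ‖b k‖ ≤ 1) : Tendsto (fun k => b k * w k) atTop (𝓝 0) := by
  refine squeeze_zero_norm (fun k => ?_) (tendsto_zero_iff_norm_tendsto_zero.1 hw)
  exact (norm_mul_le _ _).trans (mul_le_of_le_one_left (norm_nonneg _) (hb k))

lemma Filter.Tendsto.mul_contraction {b w : ℕ → A} (hw : Tendsto w atTop (𝓝 0))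
    (hb : ∀ k, ‖b k‖ ≤ 1) : Tendsto (fun k => w k * b k) atTop (𝓝 0) := by
  refine squeeze_zero_norm (fun k => ?_) (tendsto_zero_iff_norm_tendsto_zero.1 hw)
  exact (norm_mul_le _ _).trans (mul_le_of_le_one_right (norm_nonneg _) (hb k))

lemma Filter.Tendsto.zero_mul_const {w : ℕ → A} (hw : Tendsto w atTop (𝓝 0)) (a : A) :
    Tendsto (fun k => w k * a) atTop (𝓝 0) := by
  simpa using hw.mul_const a

lemma Filter.Tendsto.const_mul_zero {w : ℕ → A} (hw : Tendsto w atTop (𝓝 0)) (a : A) :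
    Tendsto (fun k => a * w k) atTop (𝓝 0) := by
  simpa using hw.const_mul a

lemma tendsto_zero_sum {ι : Type*} (S : Finset ι) {w : ι → ℕ → A}
    (hw : ∀ i ∈ S, Tendsto (w i) atTop (𝓝 0)) :
    Tendsto (fun k => ∑ i ∈ S, w i k) atTop (𝓝 0) := by
  simpa using tendsto_finsetSum S hw

lemma Filter.Tendsto.eventually_norm_lt {w : ℕ → A} (hw : Tendsto w atTop (𝓝 0)) {ε : ℝ}
    (hε : 0 < ε) : ∀ᶠ k in atTop, ‖w k‖ < ε :=
  (tendsto_zero_iff_norm_tendsto_zero.1 hw).eventually (gt_mem_nhds hε)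

/-- A retraction of `G` onto the stabilizer which is equivariant for left multiplication. -/
lemma exists_equivariant_retraction (τ : Finset G) :
    ∃ q : G → G, (∀ g, q g ∈ stab τ) ∧ ∀ h ∈ stab τ, ∀ g, q (h * g) = h * q g := by
  let H : Subgroup G := MulAction.stabilizer G τ
  have hH : ∀ g, g ∈ H ↔ g ∈ stab τ := fun g => by rw [mem_stab, MulAction.mem_stabilizer_iff]
  let r : G → G := fun g => (Quotient.mk (QuotientGroup.rightRel H) g).out
  refine ⟨fun g => g * (r g)⁻¹, fun g => ?_, fun h hh g => ?_⟩
  · rw [← hH, ← QuotientGroup.rightRel_apply]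
    exact Quotient.mk_out (s := QuotientGroup.rightRel H) g
  · have : r (h * g) = r g := by
      refine congrArg Quotient.out (Quotient.sound (s := QuotientGroup.rightRel H) ?_)
      refine QuotientGroup.rightRel_apply.2 ?_
      rw [hH]
      simpa using inv_mem_stab hh
    simp only [this, mul_assoc]

/-- If a summand of `α` containing `A_τ` has Rokhlin towers, so has `H_τ ↷ A_τ`; the proposition
`c` selects whether commuting towers are required. -/
lemma exists_subgroup_towers (hdec : NDecomposition α n) {τ : Finset G} (hτ : τ ∈ nTuples G n)
    {d : ℕ} (c : Prop)
    (H : ∀ ε > (0 : ℝ), ∀ F : Finset A, ↑F ⊆ domInter α τ → ∃ f : G → Fin (d + 1) → A,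
      RokhlinTowers α d F ε f ∧ (c → CommutingTowers d F ε f))
    {ε : ℝ} (hε : 0 < ε) (F : Finset A) (hF : ↑F ⊆ domInter α τ) :
    ∃ f : G → Fin (d + 1) → A, SubgroupRokhlinTowers α τ d F ε f ∧
      (c → ∀ h ∈ stab τ, ∀ h' ∈ stab τ, ∀ j k : Fin (d + 1), ∀ a ∈ F,
        ‖(f h j * f h' k - f h' k * f h j) * a‖ < ε) := by
  classical
  let F2 : Finset A := F ∪ (stab τ ×ˢ F).image fun p => α.act p.1 p.2
  have hFF2 : ∀ a ∈ F, a ∈ F2 := fun a ha => Finset.mem_union_left _ ha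
  have hact2 : ∀ h ∈ stab τ, ∀ x ∈ F, α.act h x ∈ F2 := fun h hh x hx =>
    Finset.mem_union_right _ (Finset.mem_image.2 ⟨(h, x), Finset.mk_mem_product hh hx, rfl⟩)
  have hF2 : ∀ y ∈ F2, y ∈ domInter α τ := by
    intro y hy
    rcases Finset.mem_union.1 hy with hy | hy
    · exact hF hy
    · obtain ⟨p, hp, rfl⟩ := Finset.mem_image.1 hy
      rw [Finset.mem_product] at hp
      exact act_mem_domInter_of_stab hτ hp.1 (hF hp.2)
  have hk0 : ∀ k : ℕ, 0 < 1 / ((k : ℝ) + 1) := fun k => Nat.one_div_pos_of_nat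
  have hE : ∀ k : ℕ, ∃ e : A, (IsPosContraction e ∧ e ∈ domInter α τ) ∧
      ∀ y ∈ F2, ‖e * y - y‖ < 1 / ((k : ℝ) + 1) := by
    intro k
    obtain ⟨e, he, hy⟩ := exists_approx_unit F2 (hk0 k)
    refine ⟨compHom hdec τ e, ⟨he.map _, compHom_mem hdec τ e⟩, fun y hyF => ?_⟩
    rw [← mul_of_mem_domInter hdec hτ e (hF2 y hyF)]
    exact hy y hyF
  choose e he hey using hE
  have hins : ∀ k, ∀ y ∈ insert (e k) F2, y ∈ domInter α τ := by
    intro k y hy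
    rcases Finset.mem_insert.1 hy with rfl | hy
    · exact (he k).2
    · exact hF2 y hy
  choose f hf hfc using fun k : ℕ => H _ (hk0 k) (insert (e k) F2) (fun y hy => hins k y hy)
  have heI : ∀ k, e k ∈ insert (e k) F2 := fun k => Finset.mem_insert_self _ _
  have hI2 : ∀ k, ∀ y ∈ F2, y ∈ insert (e k) F2 := fun k y hy => Finset.mem_insert_of_mem hy
  let u : ℕ → G → Fin (d + 1) → A := fun k g j => compHom hdec τ (f k g j)
  have hfu : ∀ k g j, ∀ y ∈ domInter α τ, f k g j * y = u k g j * y := fun k g j y hy =>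
    mul_of_mem_domInter hdec hτ _ hy
  have hu : ∀ k g j, IsPosContraction (u k g j) := fun k g j => ((hf k).1 g j).2.map _
  have humem : ∀ k g j, u k g j ∈ domInter α τ := fun k g j => compHom_mem hdec τ _
  have hu1 : ∀ g j, ∀ k, ‖u k g j‖ ≤ 1 := fun g j k => (hu k g j).2
  have he1 : ∀ k, ‖e k‖ ≤ 1 := fun k => (he k).1.2
  have huequi : ∀ h ∈ stab τ, ∀ g j, ∀ a ∈ F, ∀ x ∈ F, Tendsto (fun k =>
      (α.act h (u k g j * x) - u k (h * g) j * α.act h x) * a) atTop (𝓝 0) := by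
    intro h hh g j a ha x hx
    refine tendsto_zero_of_norm_lt fun k => ?_
    have := (hf k).2.1 h g j a (hI2 k a (hFF2 a ha)) x (hI2 k x (hFF2 x hx))
      (domInter_subset_dom (mem_of_mem_stab hτ (inv_mem_stab hh)) (hF hx))
    rwa [hfu k g j x (hF hx), hfu k (h * g) j _ (act_mem_domInter_of_stab hτ hh (hF hx))] at this
  have huorth : ∀ j, ∀ g g' : G, g ≠ g' →
      Tendsto (fun k => u k g j * u k g' j * e k) atTop (𝓝 0) := by
    intro j g g' hg
    refine tendsto_zero_of_norm_lt fun k => ?_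
    have := (hf k).2.2.1 j g g' hg (e k) (heI k)
    rwa [mul_of_mem_domInter hdec hτ _ (he k).2, map_mul] at this
  have husum : ∀ a ∈ F, Tendsto (fun k => (∑ j, ∑ g : G, u k g j) * a - a) atTop (𝓝 0) := by
    intro a ha
    refine tendsto_zero_of_norm_lt fun k => ?_
    have := (hf k).2.2.2.1 a (hI2 k a (hFF2 a ha))
    rw [mul_of_mem_domInter hdec hτ _ (hF ha)] at this
    simpa only [map_sum] using this
  have hucomm : ∀ g j, ∀ a b : ℕ → A, (∀ k, a k ∈ insert (e k) F2) →
      (∀ k, b k ∈ insert (e k) F2) →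
      Tendsto (fun k => (u k g j * b k - b k * u k g j) * a k) atTop (𝓝 0) := by
    intro g j a b ha hb
    refine tendsto_zero_of_norm_lt fun k => ?_
    have := (hf k).2.2.2.2 g j (a k) (ha k) (b k) (hb k)
    rwa [mul_of_mem_domInter hdec hτ _ (hins k _ (ha k)), map_sub, map_mul, map_mul,
      compHom_of_mem hdec hτ (hins k _ (hb k))] at this
  have hutower : c → ∀ g g' j j',
      Tendsto (fun k => (u k g j * u k g' j' - u k g' j' * u k g j) * e k) atTop (𝓝 0) := by
    intro hc g g' j j'
    refine tendsto_zero_of_norm_lt fun k => ?_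
    have := hfc k hc g g' j j' (e k) (heI k)
    rwa [mul_of_mem_domInter hdec hτ _ (he k).2, map_sub, map_mul, map_mul] at this
  have heF : ∀ y ∈ F2, Tendsto (fun k => e k * y - y) atTop (𝓝 0) := fun y hy =>
    tendsto_zero_of_norm_lt fun k => hey k y hy
  let w : ℕ → G → Fin (d + 1) → A := fun k g j => e k * u k g j * e k
  have hw : ∀ k g j, IsPosContraction (w k g j) := fun k g j => (he k).1.conj (hu k g j)
  have hwu : ∀ g j, ∀ y ∈ F2, Tendsto (fun k => w k g j * y - u k g j * y) atTop (𝓝 0) := by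
    intro g j y hy
    have h1 := ((heF y hy).contraction_mul (hu1 g j)).contraction_mul he1
    have h2 := (heF y hy).contraction_mul (hu1 g j)
    have h3 := hucomm g j (fun _ => y) e (fun k => hI2 k y hy) heI
    have h4 := (h1.sub h3).add h2
    simp only [sub_zero, add_zero] at h4
    refine h4.congr fun k => ?_
    simp only [w]
    noncomm_ring
  have hww : ∀ g g' j j', Tendsto (fun k => w k g j * w k g' j' -
      e k * (u k g j * u k g' j' * e k) * e k * e k) atTop (𝓝 0) := by
    intro g g' j j'
    have hD := hucomm g' j' e e heI heI
    have h1 := hD.contraction_mul fun k => (hw k g j).2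
    have h2 := ((hD.contraction_mul (hu1 g j)).contraction_mul he1).mul_contraction he1
    have h3 := (h1.add h2).neg
    simp only [add_zero, neg_zero] at h3
    refine h3.congr fun k => ?_
    simp only [w]
    noncomm_ring
  have hworth : ∀ j, ∀ g g' : G, g ≠ g' →
      Tendsto (fun k => w k g j * w k g' j) atTop (𝓝 0) := by
    intro j g g' hg
    have h1 := (((huorth j g g' hg).contraction_mul he1).mul_contraction he1).mul_contraction he1
    have h2 := (hww g g' j j).add h1
    simp only [add_zero] at h2
    exact h2.congr fun k => by abel
  have hwtower : c → ∀ g g' j j',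
      Tendsto (fun k => w k g j * w k g' j' - w k g' j' * w k g j) atTop (𝓝 0) := by
    intro hc g g' j j'
    have h1 := (((hutower hc g g' j j').contraction_mul he1).mul_contraction he1).mul_contraction
      he1
    have h2 := ((hww g g' j j').sub (hww g' g j' j)).add h1
    simp only [add_zero, sub_zero] at h2
    refine h2.congr fun k => ?_
    noncomm_ring
  obtain ⟨q, hq, hqmul⟩ := exists_equivariant_retraction τ
  let S : G → Finset G := fun h => Finset.univ.filter fun g => q g = h
  let U : ℕ → G → Fin (d + 1) → A := fun k h j => ∑ g ∈ S h, u k g j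
  let v : ℕ → G → Fin (d + 1) → A := fun k h j => ∑ g ∈ S h, w k g j
  let m : ℕ → G → Fin (d + 1) → ℝ := fun k h j => max 1 ‖v k h j‖
  let v' : ℕ → G → Fin (d + 1) → A := fun k h j => (m k h j)⁻¹ • v k h j
  have hm1 : ∀ k h j, 1 ≤ m k h j := fun k h j => le_max_left _ _
  have hm0 : ∀ k h j, 0 < m k h j := fun k h j => zero_lt_one.trans_le (hm1 k h j)
  have hminv : ∀ k h j, (m k h j)⁻¹ ≤ 1 := fun k h j => inv_le_one_of_one_le₀ (hm1 k h j)
  have hv' : ∀ k h j, IsPosContraction (v' k h j) := by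
    intro k h j
    refine ⟨exists_smul_eq_star_mul_self (exists_sum_eq_star_mul_self _ _ fun g _ => (hw k g j).1)
      (inv_nonneg.2 (hm0 k h j).le), ?_⟩
    rw [norm_smul, norm_inv, Real.norm_of_nonneg (hm0 k h j).le, inv_mul_le_one₀ (hm0 k h j)]
    exact le_max_right _ _
  have hv'mem : ∀ k h j, v' k h j ∈ domInter α τ := by
    intro k h j
    have : v k h j ∈ domInter α τ := domInter_sum _ _ fun g _ =>
      domInter_mul_left _ (he k).2
    have h2 := domInter_smul (((m k h j)⁻¹ : ℝ) : ℂ) this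
    simpa only [Complex.coe_smul] using h2
  have hmlim : ∀ h j, Tendsto (fun k => m k h j - 1) atTop (𝓝 0) := by
    intro h j
    have hη : Tendsto (fun k => ∑ g ∈ S h, ∑ g' ∈ (S h).erase g, ‖w k g j * w k g' j‖) atTop
        (𝓝 0) := by
      have := tendsto_finsetSum (S h) fun g _ => tendsto_finsetSum ((S h).erase g) fun g' hg' =>
        tendsto_zero_iff_norm_tendsto_zero.1 (hworth j g g' (Finset.ne_of_mem_erase hg').symm)
      simpa using this
    refine squeeze_zero (fun k => sub_nonneg.2 (hm1 k h j)) (fun k => ?_) hη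
    have h1 := norm_sum_sq_le (S h) (fun g => w k g j) fun g _ => hw k g j
    have h0 : 0 ≤ ∑ g ∈ S h, ∑ g' ∈ (S h).erase g, ‖w k g j * w k g' j‖ :=
      Finset.sum_nonneg fun g _ => Finset.sum_nonneg fun g' _ => norm_nonneg _
    change ‖v k h j‖ ^ 2 ≤ ‖v k h j‖ + _ at h1
    simp only [m]
    rcases le_total ‖v k h j‖ 1 with hle | hle
    · rw [max_eq_left hle, sub_self]
      exact h0
    · rw [max_eq_right hle]
      nlinarith
  have hv'v : ∀ h j, Tendsto (fun k => v' k h j - v k h j) atTop (𝓝 0) := by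
    intro h j
    refine squeeze_zero_norm (fun k => ?_) (hmlim h j)
    have h1 : v' k h j - v k h j = ((m k h j)⁻¹ - 1) • v k h j := by
      simp only [v', sub_smul, one_smul]
    have h2 : ‖(m k h j)⁻¹ - 1‖ = 1 - (m k h j)⁻¹ := by
      rw [norm_sub_rev, Real.norm_of_nonneg (sub_nonneg.2 (hminv k h j))]
    rw [h1, norm_smul, h2]
    calc (1 - (m k h j)⁻¹) * ‖v k h j‖ ≤ (1 - (m k h j)⁻¹) * m k h j :=
          mul_le_mul_of_nonneg_left (le_max_right _ _) (sub_nonneg.2 (hminv k h j))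
      _ = m k h j - 1 := by
          have := (hm0 k h j).ne'
          field_simp
  have hv'U : ∀ h j, ∀ y ∈ F2, Tendsto (fun k => v' k h j * y - U k h j * y) atTop (𝓝 0) := by
    intro h j y hy
    have h1 := ((hv'v h j).zero_mul_const y).add (tendsto_zero_sum (S h) fun g _ => hwu g j y hy)
    simp only [add_zero] at h1
    refine h1.congr fun k => ?_
    have h2 : ∑ g ∈ S h, (w k g j * y - u k g j * y) = v k h j * y - U k h j * y := by
      simp only [v, U, Finset.sum_sub_distrib, Finset.sum_mul]
    rw [h2, sub_mul]
    abel
  have hUact : ∀ h ∈ stab τ, ∀ k' j k, U k (h * k') j = ∑ g ∈ S k', u k (h * g) j := by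
    intro h hh k' j k
    refine (Finset.sum_bij (fun g _ => h * g) ?_ ?_ ?_ ?_).symm
    · intro g hg
      simp only [S, Finset.mem_filter_univ] at hg ⊢
      rw [hqmul h hh, hg]
    · intro g _ g' _ hgg
      exact mul_left_cancel hgg
    · intro g hg
      simp only [S, Finset.mem_filter_univ] at hg
      refine ⟨h⁻¹ * g, ?_, by simp⟩
      simp only [S, Finset.mem_filter_univ]
      rw [hqmul _ (inv_mem_stab hh), hg, inv_mul_cancel_left]
    · intro g _
      rfl
  have hequi : ∀ h ∈ stab τ, ∀ k' j, ∀ a ∈ F, ∀ x ∈ F, Tendsto (fun k =>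
      (α.act h (v' k k' j * x) - v' k (h * k') j * α.act h x) * a) atTop (𝓝 0) := by
    intro h hh k' j a ha x hx
    have hhτ : h⁻¹ ∈ τ := mem_of_mem_stab hτ (inv_mem_stab hh)
    let Ψ : A →⋆ₙₐ[ℂ] A := actHom hdec h τ hhτ
    have hΨ : ∀ z ∈ domInter α τ, Ψ z = α.act h z := fun z hz => actHom_of_mem hdec hτ hhτ hz
    have h1 : Tendsto (fun k => Ψ (v' k k' j * x - U k k' j * x) * a) atTop (𝓝 0) := by
      refine Tendsto.zero_mul_const ?_ a
      exact squeeze_zero_norm (fun k => NonUnitalStarAlgHom.norm_apply_le Ψ _)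
        (tendsto_zero_iff_norm_tendsto_zero.1 (hv'U k' j x (hFF2 x hx)))
    have h2 := tendsto_zero_sum (S k') fun g _ => huequi h hh g j a ha x hx
    have h3 := (hv'U (h * k') j _ (hact2 h hh x hx)).zero_mul_const a
    have h4 := (h1.add h2).sub h3
    simp only [add_zero, sub_zero] at h4
    refine h4.congr fun k => ?_
    have h5 : ∑ g ∈ S k', (α.act h (u k g j * x) - u k (h * g) j * α.act h x) * a =
        (Ψ (U k k' j * x) - U k (h * k') j * α.act h x) * a := by
      have hΨU : Ψ (U k k' j * x) = ∑ g ∈ S k', α.act h (u k g j * x) := by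
        simp only [U, Finset.sum_mul, map_sum]
        exact Finset.sum_congr rfl fun g _ => hΨ _ (domInter_mul_left _ (hF hx))
      rw [hΨU, hUact h hh, ← Finset.sum_mul, Finset.sum_sub_distrib, ← Finset.sum_mul]
    rw [h5, map_sub, hΨ (v' k k' j * x) (domInter_mul_left _ (hF hx))]
    noncomm_ring
  have hsmul : ∀ k h h' j j', v' k h j * v' k h' j' =
      ((m k h j)⁻¹ * (m k h' j')⁻¹) • (v k h j * v k h' j') := by
    intro k h h' j j'
    simp only [v', smul_mul_smul_comm]
  have hmm : ∀ k h h' j j', ‖(m k h j)⁻¹ * (m k h' j')⁻¹‖ ≤ 1 := by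
    intro k h h' j j'
    have h1 := inv_nonneg.2 (hm0 k h j).le
    have h2 := inv_nonneg.2 (hm0 k h' j').le
    rw [Real.norm_of_nonneg (mul_nonneg h1 h2)]
    exact mul_le_one₀ (hminv k h j) h2 (hminv k h' j')
  have horth : ∀ j, ∀ h h' : G, h ≠ h' → ∀ a, Tendsto (fun k =>
      v' k h j * v' k h' j * a) atTop (𝓝 0) := by
    intro j h h' hne a
    refine Tendsto.zero_mul_const ?_ a
    have h1 : Tendsto (fun k => v k h j * v k h' j) atTop (𝓝 0) := by
      simp only [v, Finset.sum_mul_sum]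
      refine tendsto_zero_sum _ fun g hg => tendsto_zero_sum _ fun g' hg' => hworth j g g' ?_
      rintro rfl
      simp only [S, Finset.mem_filter_univ] at hg hg'
      exact hne (hg.symm.trans hg')
    refine squeeze_zero_norm (fun k => ?_) (tendsto_zero_iff_norm_tendsto_zero.1 h1)
    rw [hsmul, norm_smul]
    exact mul_le_of_le_one_left (norm_nonneg _) (hmm k h h' j j)
  have hsum : ∀ a ∈ F, Tendsto (fun k => (∑ j, ∑ h ∈ stab τ, v' k h j) * a - a) atTop (𝓝 0) := by
    intro a ha
    have h1 := (tendsto_zero_sum Finset.univ fun j _ => tendsto_zero_sum (stab τ) fun h _ =>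
      hv'U h j a (hFF2 a ha)).add (husum a ha)
    simp only [add_zero] at h1
    refine h1.congr fun k => ?_
    have h2 : ∀ j, ∑ g : G, u k g j = ∑ h ∈ stab τ, U k h j := fun j =>
      (Finset.sum_fiberwise_of_maps_to (fun g _ => hq g) _).symm
    simp only [h2, Finset.sum_sub_distrib, Finset.sum_mul]
    abel
  have hcomm : ∀ h j, ∀ a ∈ F, ∀ b ∈ F, Tendsto (fun k =>
      (v' k h j * b - b * v' k h j) * a) atTop (𝓝 0) := by
    intro h j a ha b hb
    have h1 := (hv'U h j b (hFF2 b hb)).zero_mul_const a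
    have h2 := (hv'U h j a (hFF2 a ha)).const_mul_zero b
    have h3 := tendsto_zero_sum (S h) fun g _ => hucomm g j (fun _ => a) (fun _ => b)
      (fun k => hI2 k a (hFF2 a ha)) (fun k => hI2 k b (hFF2 b hb))
    have h4 := (h1.sub h2).add h3
    simp only [add_zero, sub_zero] at h4
    refine h4.congr fun k => ?_
    have h5 : ∑ g ∈ S h, (u k g j * b - b * u k g j) * a = (U k h j * b - b * U k h j) * a := by
      rw [← Finset.sum_mul, Finset.sum_sub_distrib, ← Finset.sum_mul, ← Finset.mul_sum]
    rw [h5]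
    noncomm_ring
  have htower : c → ∀ h h' j j', ∀ a, Tendsto (fun k =>
      (v' k h j * v' k h' j' - v' k h' j' * v' k h j) * a) atTop (𝓝 0) := by
    intro hc h h' j j' a
    refine Tendsto.zero_mul_const ?_ a
    have h1 : Tendsto (fun k => v k h j * v k h' j' - v k h' j' * v k h j) atTop (𝓝 0) := by
      have := tendsto_zero_sum (S h) fun g _ => tendsto_zero_sum (S h') fun g' _ =>
        hwtower hc g g' j j'
      refine this.congr fun k => ?_
      simp only [v, Finset.sum_mul_sum, Finset.sum_sub_distrib]
      rw [Finset.sum_comm (s := S h') (t := S h)]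
    refine squeeze_zero_norm (fun k => ?_) (tendsto_zero_iff_norm_tendsto_zero.1 h1)
    rw [hsmul, hsmul, mul_comm (m k h' j')⁻¹, ← smul_sub, norm_smul]
    exact mul_le_of_le_one_left (norm_nonneg _) (hmm k h h' j j')
  have hev : ∀ᶠ k in atTop, SubgroupRokhlinTowers α τ d F ε (v' k) ∧
      (c → ∀ h ∈ stab τ, ∀ h' ∈ stab τ, ∀ j j' : Fin (d + 1), ∀ a ∈ F,
        ‖(v' k h j * v' k h' j' - v' k h' j' * v' k h j) * a‖ < ε) := by
    unfold SubgroupRokhlinTowers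
    simp only [eventually_and, eventually_all, eventually_all_finset]
    exact ⟨⟨fun h _ j => ⟨.of_forall fun k => hv'mem k h j, .of_forall fun k => hv' k h j⟩,
      fun h hh k' _ j a ha x hx => (hequi h hh k' j a ha x hx).eventually_norm_lt hε,
      fun j h _ h' _ hne a _ => (horth j h h' hne a).eventually_norm_lt hε,
      fun a ha => (hsum a ha).eventually_norm_lt hε,
      fun h _ j a ha b hb => (hcomm h j a ha b hb).eventually_norm_lt hε⟩,
      fun hc h _ h' _ j j' a _ => (htower hc h h' j j' a).eventually_norm_lt hε⟩
  obtain ⟨k, hk⟩ := hev.exists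
  exact ⟨v' k, hk⟩

end Restriction

section Induction

set_option linter.unusedSectionVars false

variable {G : Type*} [Group G] [Fintype G] [DecidableEq G] {A : Type*} [NonUnitalCStarAlgebra A]
variable {α : CStarPartialAction G A} {n : ℕ}

/-- Rokhlin towers of the subsystems `H_τ ↷ A_τ` for representatives `τ = ρ σ` of the orbits in
an invariant family `Ω` of tuples induce Rokhlin towers on the summand `⨁_{σ ∈ Ω} A_σ`; the
proposition `c` selects whether commuting towers are required. -/
lemma exists_towers_of_subgroup_towers (hdec : NDecomposition α n) {d : ℕ} (c : Prop)
    {Ω : Finset (Finset G)} (hΩ : Ω ⊆ nTuples G n)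
    (hΩg : ∀ σ ∈ Ω, ∀ g : G, g⁻¹ ∈ σ → g • σ ∈ Ω) (ρ : Finset G → Finset G) (s : Finset G → G)
    (hρ : ∀ σ ∈ Ω, ρ σ ∈ nTuples G n) (hs : ∀ σ ∈ Ω, s σ • ρ σ = σ)
    (hρg : ∀ σ ∈ Ω, ∀ g : G, g⁻¹ ∈ σ → ρ (g • σ) = ρ σ)
    (H : ∀ σ ∈ Ω, ∀ ε > (0 : ℝ), ∀ F : Finset A, ↑F ⊆ domInter α (ρ σ) →
      ∃ u : G → Fin (d + 1) → A, SubgroupRokhlinTowers α (ρ σ) d F ε u ∧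
        (c → ∀ h ∈ stab (ρ σ), ∀ h' ∈ stab (ρ σ), ∀ j k : Fin (d + 1), ∀ a ∈ F,
          ‖(u h j * u h' k - u h' k * u h j) * a‖ < ε))
    {ε : ℝ} (hε : 0 < ε) (F : Finset A)
    (hF : ∀ a ∈ F, ∀ σ ∈ nTuples G n, σ ∉ Ω → compHom hdec σ a = 0) :
    ∃ f : G → Fin (d + 1) → A, (RokhlinTowers α d F ε f ∧ (c → CommutingTowers d F ε f)) ∧
      ∀ g j, ∀ σ ∈ nTuples G n, σ ∉ Ω → compHom hdec σ (f g j) = 0 := by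
  classical
  have hsσ : ∀ σ ∈ Ω, s σ ∈ σ := fun σ hσ => by
    have := Finset.smul_mem_smul_finset (a := s σ) (mem_nTuples.1 (hρ σ hσ)).1
    rwa [hs σ hσ, smul_eq_mul, mul_one] at this
  have hsρ : ∀ σ ∈ Ω, (s σ)⁻¹ ∈ ρ σ := fun σ hσ => by
    have h1 := (mem_nTuples.1 (hΩ hσ)).1
    rw [← hs σ hσ] at h1
    obtain ⟨t, ht, hst⟩ := Finset.mem_smul_finset.1 h1
    rwa [← eq_inv_of_mul_eq_one_right hst]
  let B : Finset G → A → A := fun σ a => α.act (s σ)⁻¹ (compHom hdec σ a)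
  have hB : ∀ σ ∈ Ω, ∀ a, B σ a ∈ domInter α (ρ σ) := fun σ hσ a => by
    have := act_mem_domInter (g := (s σ)⁻¹) (by rw [inv_inv]; exact hsσ σ hσ)
      (compHom_mem hdec σ a)
    have h2 : (s σ)⁻¹ • σ = ρ σ := by rw [inv_smul_eq_iff, hs σ hσ]
    rwa [h2] at this
  have hΦ : ∀ σ, ∃ Φ : A →⋆ₙₐ[ℂ] A, σ ∈ Ω → ∀ x ∈ domInter α (ρ σ), Φ x = α.act (s σ) x := by
    intro σ
    by_cases hσ : σ ∈ Ω
    · exact ⟨actHom hdec (s σ) (ρ σ) (hsρ σ hσ), fun _ x hx => actHom_of_mem hdec (hρ σ hσ) _ hx⟩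
    · exact ⟨0, fun h => absurd h hσ⟩
  choose Φ hΦ using hΦ
  have hΦB : ∀ σ ∈ Ω, ∀ a, Φ σ (B σ a) = compHom hdec σ a := fun σ hσ a => by
    rw [hΦ σ hσ _ (hB σ hσ a)]
    have := α.act_inv_act (s σ)⁻¹ (compHom hdec σ a)
      (by rw [inv_inv]; exact domInter_subset_dom (hsσ σ hσ) (compHom_mem hdec σ a))
    rwa [inv_inv] at this
  have hΦmem : ∀ σ ∈ Ω, ∀ x ∈ domInter α (ρ σ), Φ σ x ∈ domInter α σ := fun σ hσ x hx => by
    rw [hΦ σ hσ x hx]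
    have := act_mem_domInter (hsρ σ hσ) hx
    rwa [hs σ hσ] at this
  let Fρ : Finset G → Finset A := fun τ =>
    (F ×ˢ Ω.filter fun σ => ρ σ = τ).image fun p => B p.2 p.1
  have hFρ : ∀ σ ∈ Ω, ∀ a ∈ F, B σ a ∈ Fρ (ρ σ) := fun σ hσ a ha =>
    Finset.mem_image.2 ⟨(a, σ), by simp [ha, hσ], rfl⟩
  have hu : ∀ τ, ∃ u : G → Fin (d + 1) → A, (∃ σ ∈ Ω, ρ σ = τ) →
      SubgroupRokhlinTowers α τ d (Fρ τ) ε u ∧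
        (c → ∀ h ∈ stab τ, ∀ h' ∈ stab τ, ∀ j k : Fin (d + 1), ∀ a ∈ Fρ τ,
          ‖(u h j * u h' k - u h' k * u h j) * a‖ < ε) := by
    intro τ
    by_cases hτ : ∃ σ ∈ Ω, ρ σ = τ
    · obtain ⟨σ, hσ, rfl⟩ := hτ
      obtain ⟨u, hu⟩ := H σ hσ ε hε (Fρ (ρ σ)) (by
        intro y hy
        obtain ⟨p, hp, rfl⟩ := Finset.mem_image.1 (Finset.mem_coe.1 hy)
        rw [Finset.mem_product, Finset.mem_filter] at hp
        have := hB p.2 hp.2.1 p.1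
        rwa [hp.2.2] at this)
      exact ⟨u, fun _ => hu⟩
    · exact ⟨0, fun h => absurd h hτ⟩
  choose u hu using hu
  replace hu := fun σ hσ => hu (ρ σ) ⟨σ, hσ, rfl⟩
  let w : Finset G → G → Fin (d + 1) → A := fun σ g j =>
    if (s σ)⁻¹ * g ∈ stab (ρ σ) then u (ρ σ) ((s σ)⁻¹ * g) j else 0
  have hw : ∀ σ ∈ Ω, ∀ g j, w σ g j ∈ domInter α (ρ σ) ∧ IsPosContraction (w σ g j) := by
    intro σ hσ g j
    simp only [w]
    split_ifs with h
    · exact (hu σ hσ).1.1 _ h j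
    · exact ⟨domInter_zero _, .zero⟩
  have hwΦ : ∀ σ ∈ Ω, ∀ g j, Φ σ (w σ g j) ∈ α.dom g := by
    intro σ hσ g j
    by_cases h : (s σ)⁻¹ * g ∈ stab (ρ σ)
    · refine domInter_subset_dom (σ := σ) ?_ (hΦmem σ hσ _ (hw σ hσ g j).1)
      have := Finset.smul_mem_smul_finset (a := s σ) (mem_of_mem_stab (hρ σ hσ) h)
      rwa [hs σ hσ, smul_eq_mul, mul_inv_cancel_left] at this
    · simp only [w, if_neg h, map_zero, α.zero_mem]
  let f : G → Fin (d + 1) → A := fun g j =>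
    ∑ σ ∈ nTuples G n, if σ ∈ Ω then Φ σ (w σ g j) else 0
  have hcomp' : ∀ g j, ∀ σ ∈ nTuples G n,
      compHom hdec σ (f g j) = if σ ∈ Ω then Φ σ (w σ g j) else 0 := by
    intro g j σ hσ
    refine compHom_sum hdec (c := fun σ => if σ ∈ Ω then Φ σ (w σ g j) else 0) ?_ hσ
    intro τ _
    split_ifs with h
    · exact hΦmem τ h _ (hw τ h g j).1
    · exact domInter_zero τ
  have hcomp : ∀ g j, ∀ σ ∈ Ω, compHom hdec σ (f g j) = Φ σ (w σ g j) := fun g j σ hσ => by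
    rw [hcomp' g j σ (hΩ hσ), if_pos hσ]
  have hcomp0 : ∀ g j, ∀ σ ∈ nTuples G n, σ ∉ Ω → compHom hdec σ (f g j) = 0 :=
    fun g j σ hσ h => by rw [hcomp' g j σ hσ, if_neg h]
  have hlt : ∀ y : A, ∀ a ∈ F, (∀ σ ∈ Ω, ∃ z, compHom hdec σ (y * a) = Φ σ z ∧ ‖z‖ < ε) →
      ‖y * a‖ < ε := by
    intro y a ha h
    refine norm_lt_of_comp hdec hε fun σ hσ => ?_
    by_cases hσΩ : σ ∈ Ω
    · obtain ⟨z, hz, hzε⟩ := h σ hσΩ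
      rw [hz]
      exact (NonUnitalStarAlgHom.norm_apply_le (Φ σ) z).trans_lt hzε
    · rw [map_mul, hF a ha σ hσ hσΩ, mul_zero, norm_zero]
      exact hε
  refine ⟨f, ⟨⟨fun g j => ⟨?_, ?_, ?_⟩, ?_, ?_, ?_, ?_⟩, ?_⟩, hcomp0⟩
  · refine α.dom_sum g _ _ fun σ _ => ?_
    split_ifs with h
    · exact hwΦ σ h g j
    · exact α.zero_mem g
  · refine exists_sum_eq_star_mul_self _ _ fun σ _ => ?_
    split_ifs with h
    · exact ((hw σ h g j).2.map (Φ σ)).1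
    · exact IsPosContraction.zero.1
  · refine norm_le_of_comp hdec zero_le_one fun σ hσ => ?_
    rw [hcomp' g j σ hσ]
    split_ifs with h
    · exact ((hw σ h g j).2.map (Φ σ)).2
    · exact IsPosContraction.zero.2
  · intro g h j a ha x hx hxg
    refine hlt _ a ha fun σ' hσ' => ?_
    by_cases hg : g ∈ σ'
    · obtain ⟨σ, hσ, hgσ, rfl⟩ : ∃ σ ∈ Ω, g⁻¹ ∈ σ ∧ g • σ = σ' := by
        refine ⟨g⁻¹ • σ', hΩg σ' hσ' g⁻¹ (by rwa [inv_inv]), ?_, smul_inv_smul g σ'⟩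
        have := Finset.smul_mem_smul_finset (a := g⁻¹) (mem_nTuples.1 (hΩ hσ')).1
        rwa [smul_eq_mul, mul_one] at this
      have hρσ := hρg σ hσ g hgσ
      let h' : G := (s (g • σ))⁻¹ * (g * s σ)
      have hh' : h' ∈ stab (ρ σ) := by
        rw [mem_stab]
        simp only [h', mul_smul]
        rw [hs σ hσ, inv_smul_eq_iff, ← hρσ, hs _ hσ']
      have hact : ∀ z ∈ domInter α (ρ σ), α.act g (Φ σ z) = Φ (g • σ) (α.act h' z) := by
        intro z hz
        have h1 : (g * s σ)⁻¹ ∈ ρ σ := by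
          have h3 := mem_of_mem_stab (hρ σ hσ) (inv_mem_stab hh')
          have h4 := hsρ _ hσ'
          rw [hρσ] at h4
          have h5 := (mul_mem_iff_of_mem_stab (inv_mem_stab hh')).2 h4
          simpa [h', mul_assoc] using h5
        rw [hΦ σ hσ z hz, hΦ _ hσ' _ (by rw [hρσ]; exact act_mem_domInter_of_stab (hρ σ hσ) hh' hz),
          ← α.act_comp g (s σ) z ⟨domInter_subset_dom (hsρ σ hσ) hz, domInter_subset_dom h1 hz⟩]
        have h2 : s (g • σ) * h' = g * s σ := by simp [h']
        rw [← α.act_comp (s (g • σ)) h' z ⟨domInter_subset_dom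
          (mem_of_mem_stab (hρ σ hσ) (inv_mem_stab hh')) hz, by
            rw [h2]; exact domInter_subset_dom h1 hz⟩, h2]
      refine ⟨(α.act h' (w σ h j * B σ x) - w (g • σ) (g * h) j * α.act h' (B σ x)) *
        B (g • σ) a, ?_, ?_⟩
      · rw [map_mul, map_sub, map_mul, compHom_act hdec (hΩ hσ) hgσ (α.mul_mem_left _ _ _ hxg),
          compHom_act hdec (hΩ hσ) hgσ hxg, map_mul, hcomp h j σ hσ, hcomp _ j _ hσ',
          ← hΦB σ hσ x, ← map_mul, hact _ (domInter_mul_left _ (hB σ hσ x)), hact _ (hB σ hσ x),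
          ← hΦB _ hσ' a, ← map_mul, ← map_sub, ← map_mul]
      · have hk : (s (g • σ))⁻¹ * (g * h) = h' * ((s σ)⁻¹ * h) := by simp [h', mul_assoc]
        have hBa := hFρ _ hσ' a ha
        simp only [w, hk]
        rw [hρσ] at hBa ⊢
        by_cases hks : (s σ)⁻¹ * h ∈ stab (ρ σ)
        · rw [if_pos hks, if_pos (mul_mem_stab hh' hks)]
          exact (hu σ hσ).1.2.1 h' hh' _ hks j _ hBa _ (hFρ σ hσ x hx)
        · have hks' : h' * ((s σ)⁻¹ * h) ∉ stab (ρ σ) := fun hc => hks (by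
            have := mul_mem_stab (inv_mem_stab hh') hc
            rwa [inv_mul_cancel_left] at this)
          rw [if_neg hks, if_neg hks']
          simpa [α.act_zero] using hε
    · refine ⟨0, ?_, by simpa using hε⟩
      rw [map_mul, map_sub, map_mul, compHom_eq_zero_of_mem_dom hdec (hΩ hσ') hg
        (α.act_mem g _ (α.mul_mem_left _ _ _ hxg)),
        compHom_eq_zero_of_mem_dom hdec (hΩ hσ') hg (α.act_mem g _ hxg)]
      simp
  · intro j g h hgh a ha
    refine hlt _ a ha fun σ hσ => ⟨w σ g j * w σ h j * B σ a, ?_, ?_⟩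
    · rw [map_mul, map_mul, hcomp g j σ hσ, hcomp h j σ hσ, map_mul, map_mul, hΦB σ hσ]
    · by_cases hg : (s σ)⁻¹ * g ∈ stab (ρ σ)
      · by_cases hh : (s σ)⁻¹ * h ∈ stab (ρ σ)
        · simp only [w, if_pos hg, if_pos hh]
          exact (hu σ hσ).1.2.2.1 j _ hg _ hh (fun he => hgh (mul_left_cancel he)) _
            (hFρ σ hσ a ha)
        · simpa [w, if_neg hh] using hε
      · simpa [w, if_neg hg] using hε
  · intro a ha
    refine norm_lt_of_comp hdec hε fun σ hσ => ?_
    by_cases hσΩ : σ ∈ Ω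
    · have hsum : ∀ j, ∑ g : G, w σ g j = ∑ h ∈ stab (ρ σ), u (ρ σ) h j := by
        intro j
        rw [Fintype.sum_equiv (Equiv.mulLeft (s σ)⁻¹) (fun g => w σ g j)
          (fun g => if g ∈ stab (ρ σ) then u (ρ σ) g j else 0) fun g => rfl,
          Finset.sum_ite_mem, Finset.univ_inter]
      have h1 : compHom hdec σ ((∑ j, ∑ g : G, f g j) * a - a) =
          Φ σ ((∑ j, ∑ h ∈ stab (ρ σ), u (ρ σ) h j) * B σ a - B σ a) := by
        simp only [← hsum, map_sub, map_mul, map_sum, hΦB σ hσΩ, hcomp _ _ σ hσΩ]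
      rw [h1]
      exact (NonUnitalStarAlgHom.norm_apply_le (Φ σ) _).trans_lt
        ((hu σ hσΩ).1.2.2.2.1 _ (hFρ σ hσΩ a ha))
    · rw [map_sub, map_mul, hF a ha σ hσ hσΩ, mul_zero, sub_zero, norm_zero]
      exact hε
  · intro g j a ha b hb
    refine hlt _ a ha fun σ hσ => ⟨(w σ g j * B σ b - B σ b * w σ g j) * B σ a, ?_, ?_⟩
    · simp only [map_mul, map_sub, hcomp g j σ hσ, hΦB σ hσ]
    · by_cases hg : (s σ)⁻¹ * g ∈ stab (ρ σ)
      · simp only [w, if_pos hg]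
        exact (hu σ hσ).1.2.2.2.2 _ hg j _ (hFρ σ hσ a ha) _ (hFρ σ hσ b hb)
      · simpa [w, if_neg hg] using hε
  · intro hc g h j k a ha
    refine hlt _ a ha fun σ hσ =>
      ⟨(w σ g j * w σ h k - w σ h k * w σ g j) * B σ a, ?_, ?_⟩
    · simp only [map_mul, map_sub, hcomp _ _ σ hσ, hΦB σ hσ]
    · by_cases hg : (s σ)⁻¹ * g ∈ stab (ρ σ)
      · by_cases hh : (s σ)⁻¹ * h ∈ stab (ρ σ)
        · simp only [w, if_pos hg, if_pos hh]
          exact (hu σ hσ).2 hc _ hg _ hh j k _ (hFρ σ hσ a ha)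
        · simpa [w, if_neg hh] using hε
      · simpa [w, if_neg hg] using hε

end Induction

section Comparison

set_option linter.unusedSectionVars false

variable {G : Type*} [Group G] [Fintype G] [DecidableEq G] {A : Type*} [NonUnitalCStarAlgebra A]
variable {α : CStarPartialAction G A} {n d : ℕ} {τ : Finset G}

lemma inv_mem_of_one_mem_smul {g : G} (h : (1 : G) ∈ g • τ) : g⁻¹ ∈ τ := by
  obtain ⟨t, ht, hgt⟩ := Finset.mem_smul_finset.1 h
  rwa [← eq_inv_of_mul_eq_one_right hgt]

/-- The tuples in the orbit of `τ`. -/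
noncomputable def orbitTuples (n : ℕ) (τ : Finset G) : Finset (Finset G) := by
  classical exact (nTuples G n).filter fun σ => ∃ g : G, g • τ = σ

lemma mem_orbitTuples {σ : Finset G} :
    σ ∈ orbitTuples n τ ↔ σ ∈ nTuples G n ∧ ∃ g : G, g • τ = σ := by
  classical
  simp [orbitTuples]

lemma exists_orbitTuples_section (τ : Finset G) :
    ∃ s : Finset G → G, ∀ σ ∈ orbitTuples n τ, s σ • τ = σ := by
  classical
  exact ⟨fun σ => if h : ∃ g : G, g • τ = σ then h.choose else 1, fun σ hσ => by
    have h := (mem_orbitTuples.1 hσ).2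
    simpa only [dif_pos h] using h.choose_spec⟩

lemma mem_orbitIdeal_iff (hdec : NDecomposition α n) (hτ : τ ∈ nTuples G n) {x : A} :
    x ∈ orbitIdeal α τ ↔
      ∀ σ ∈ nTuples G n, σ ∉ orbitTuples n τ → compHom hdec σ x = 0 := by
  constructor
  · rintro ⟨c, hc, rfl⟩ σ hσ hσΩ
    rw [map_sum]
    refine Finset.sum_eq_zero fun g hg => ?_
    have hgτ := smul_mem_nTuples hτ (Finset.mem_inv'.1 hg)
    refine compHom_ne hdec hσ hgτ ?_ (hc g hg)
    rintro rfl
    exact hσΩ (mem_orbitTuples.2 ⟨hσ, g, rfl⟩)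
  · intro h
    obtain ⟨s, hs⟩ := exists_orbitTuples_section (n := n) τ
    refine ⟨fun g => if s (g • τ) = g then compHom hdec (g • τ) x else 0, fun g _ => ?_, ?_⟩
    · dsimp only
      split_ifs
      · exact compHom_mem hdec _ x
      · exact domInter_zero _
    · have h1 : x = ∑ σ ∈ orbitTuples n τ, compHom hdec σ x := by
        conv_lhs => rw [← sum_compHom hdec x]
        exact (Finset.sum_subset (fun σ hσ => (mem_orbitTuples.1 hσ).1) fun σ hσ hσΩ =>
          h σ hσ hσΩ).symm
      rw [← Finset.sum_filter]
      refine h1.trans (Finset.sum_bij' (fun σ _ => s σ) (fun g _ => g • τ) ?_ ?_ ?_ ?_ ?_)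
      · intro σ hσ
        rw [Finset.mem_filter, hs σ hσ, Finset.mem_inv']
        refine ⟨inv_mem_of_one_mem_smul ?_, rfl⟩
        rw [hs σ hσ]
        exact (mem_nTuples.1 (mem_orbitTuples.1 hσ).1).1
      · intro g hg
        exact mem_orbitTuples.2
          ⟨smul_mem_nTuples hτ (Finset.mem_inv'.1 (Finset.mem_filter.1 hg).1), g, rfl⟩
      · exact fun σ hσ => hs σ hσ
      · exact fun g hg => (Finset.mem_filter.1 hg).2
      · intro σ hσ
        rw [hs σ hσ]

/-- Existence of Rokhlin towers for `H_τ ↷ A_τ`, which are required to commute if `c` holds. -/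
def HasSubgroupTowers (c : Prop) (α : CStarPartialAction G A) (τ : Finset G) (d : ℕ) : Prop :=
  ∀ ε > (0 : ℝ), ∀ F : Finset A, ↑F ⊆ domInter α τ → ∃ f : G → Fin (d + 1) → A,
    SubgroupRokhlinTowers α τ d F ε f ∧
      (c → ∀ h ∈ stab τ, ∀ h' ∈ stab τ, ∀ j k : Fin (d + 1), ∀ a ∈ F,
        ‖(f h j * f h' k - f h' k * f h j) * a‖ < ε)

/-- Existence of Rokhlin towers for the restriction of `α` to `I`, which are required to commute
if `c` holds. -/
def HasTowers (c : Prop) (α : CStarPartialAction G A) (I : Set A) (d : ℕ) : Prop :=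
  ∀ ε > (0 : ℝ), ∀ F : Finset A, ↑F ⊆ I → ∃ f : G → Fin (d + 1) → A,
    (RokhlinTowers α d F ε f ∧ (c → CommutingTowers d F ε f)) ∧ ∀ g j, f g j ∈ I

lemma HasTowers.subgroup (hdec : NDecomposition α n) (hτ : τ ∈ nTuples G n) {c : Prop} {I : Set A}
    (hI : domInter α τ ⊆ I) (h : HasTowers c α I d) : HasSubgroupTowers c α τ d := by
  intro ε hε F hF
  refine exists_subgroup_towers hdec hτ c (fun ε hε F hF => ?_) hε F hF
  obtain ⟨f, hf, -⟩ := h ε hε F (hF.trans hI)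
  exact ⟨f, hf⟩

lemma hasSubgroupTowers_iff (hdec : NDecomposition α n) (hτ : τ ∈ nTuples G n) (c : Prop) :
    HasSubgroupTowers c α τ d ↔ HasTowers c α (orbitIdeal α τ) d := by
  refine ⟨fun h ε hε F hF => ?_, HasTowers.subgroup hdec hτ fun x hx => ?_⟩
  · obtain ⟨s, hs⟩ := exists_orbitTuples_section (n := n) τ
    obtain ⟨f, hf, hfI⟩ := exists_towers_of_subgroup_towers hdec c (Ω := orbitTuples n τ)
      (fun σ hσ => (mem_orbitTuples.1 hσ).1) (fun σ hσ g hg => by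
        obtain ⟨hσn, k, rfl⟩ := mem_orbitTuples.1 hσ
        exact mem_orbitTuples.2 ⟨smul_mem_nTuples hσn hg, g * k, mul_smul g k τ⟩)
      (fun _ => τ) s (fun _ _ => hτ) hs (fun _ _ _ _ => rfl) (fun _ _ => h) hε F
      (fun a ha => (mem_orbitIdeal_iff hdec hτ).1 (hF ha))
    exact ⟨f, hf, fun g j => (mem_orbitIdeal_iff hdec hτ).2 (hfI g j)⟩
  · refine (mem_orbitIdeal_iff hdec hτ).2 fun σ hσ hσΩ => compHom_ne hdec hσ hτ ?_ hx
    rintro rfl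
    exact hσΩ (mem_orbitTuples.2 ⟨hσ, 1, one_smul G σ⟩)

lemma hasTowers_univ_iff (hdec : NDecomposition α n) (c : Prop) :
    HasTowers c α Set.univ d ↔ ∀ τ ∈ nTuples G n, HasSubgroupTowers c α τ d := by
  refine ⟨fun h τ hτ => h.subgroup hdec hτ (Set.subset_univ _), fun h ε hε F _ => ?_⟩
  let ρ : Finset G → Finset G := fun σ =>
    Classical.epsilon fun τ => τ ∈ nTuples G n ∧ τ ∈ MulAction.orbit G σ
  have hρ : ∀ σ ∈ nTuples G n, ρ σ ∈ nTuples G n ∧ ρ σ ∈ MulAction.orbit G σ := fun σ hσ =>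
    Classical.epsilon_spec (p := fun τ => τ ∈ nTuples G n ∧ τ ∈ MulAction.orbit G σ)
      ⟨σ, hσ, MulAction.mem_orbit_self σ⟩
  have hs : ∀ σ : Finset G, ∃ g : G, σ ∈ nTuples G n → g • ρ σ = σ := by
    intro σ
    by_cases hσ : σ ∈ nTuples G n
    · obtain ⟨g, hg⟩ := MulAction.mem_orbit_symm.1 (hρ σ hσ).2
      exact ⟨g, fun _ => hg⟩
    · exact ⟨1, fun h => absurd h hσ⟩
  choose s hs using hs
  obtain ⟨f, hf, -⟩ := exists_towers_of_subgroup_towers hdec c (Finset.Subset.refl _)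
    (fun σ hσ g hg => smul_mem_nTuples hσ hg) ρ s (fun σ hσ => (hρ σ hσ).1) hs
    (fun σ _ g _ => by simp only [ρ, MulAction.orbit_smul]) (fun σ hσ => h _ (hρ σ hσ).1) hε F
    (fun _ _ σ hσ hσ' => absurd hσ hσ')
  exact ⟨f, hf, fun _ _ => Set.mem_univ _⟩

lemma HasSubgroupTowers.mono {c : Prop} {d' : ℕ} (hd : d ≤ d') (h : HasSubgroupTowers c α τ d) :
    HasSubgroupTowers c α τ d' := by
  induction d', hd using Nat.le_induction with
  | base => exact h
  | succ d' _ ih =>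
    intro ε hε F hF
    obtain ⟨f, ⟨h0, h1, h2, h3, h4⟩, h5⟩ := ih ε hε F hF
    refine ⟨fun g => Fin.snoc (f g) 0, ⟨fun h hh j => ?_, fun h hh k hk j a ha x hx => ?_,
      fun j h hh k hk hne a ha => ?_, fun a ha => ?_, fun h hh j a ha b hb => ?_⟩,
      fun hc h hh h' hh' j k a ha => ?_⟩
    · induction j using Fin.lastCases with
      | last => simpa using ⟨domInter_zero τ, IsPosContraction.zero⟩
      | cast j => simpa using h0 h hh j
    · induction j using Fin.lastCases with
      | last => simpa [α.act_zero] using hε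
      | cast j => simpa using h1 h hh k hk j a ha x hx
    · induction j using Fin.lastCases with
      | last => simpa using hε
      | cast j => simpa using h2 j h hh k hk hne a ha
    · rw [Fin.sum_univ_castSucc]
      simpa using h3 a ha
    · induction j using Fin.lastCases with
      | last => simpa using hε
      | cast j => simpa using h4 h hh j a ha b hb
    · induction j using Fin.lastCases with
      | last => simpa using hε
      | cast j =>
        induction k using Fin.lastCases with
        | last => simpa using hε
        | cast k => simpa using h5 hc h hh h' hh' j k a ha

lemma sInf_eq_iSup_sInf {ι : Type*} {S : Finset ι} {P : ι → ℕ → Prop} {Q : ℕ → Prop}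
    (hP : ∀ i ∈ S, ∀ d d', d ≤ d' → P i d → P i d') (hQ : ∀ d, Q d ↔ ∀ i ∈ S, P i d) :
    sInf {m : ℕ∞ | ∃ d : ℕ, m = d ∧ Q d} = ⨆ i ∈ S, sInf {m : ℕ∞ | ∃ d : ℕ, m = d ∧ P i d} := by
  refine le_antisymm ?_ (iSup₂_le fun i hi => sInf_le_sInf ?_)
  · by_cases htop : (⨆ i ∈ S, sInf {m : ℕ∞ | ∃ d : ℕ, m = d ∧ P i d}) = ⊤
    · exact htop ▸ le_top
    · obtain ⟨d, hd⟩ := ENat.ne_top_iff_exists.1 htop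
      rw [← hd]
      refine sInf_le ⟨d, rfl, (hQ d).2 fun i hi => ?_⟩
      have h1 : sInf {m : ℕ∞ | ∃ d : ℕ, m = d ∧ P i d} < ((d + 1 : ℕ) : ℕ∞) :=
        ((le_iSup₂ (f := fun i _ => sInf {m : ℕ∞ | ∃ d : ℕ, m = d ∧ P i d}) i hi).trans_eq
          hd.symm).trans_lt (Nat.cast_lt.2 d.lt_succ_self)
      obtain ⟨_, ⟨d', rfl, hd'⟩, hlt⟩ := sInf_lt_iff.1 h1
      exact hP i hi d' d (Nat.lt_succ_iff.1 (Nat.cast_lt.1 hlt)) hd'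
  · rintro _ ⟨d, rfl, hd⟩
    exact ⟨d, rfl, (hQ d).1 hd i hi⟩

lemma subgroupRokhlinDim_eq (α : CStarPartialAction G A) (τ : Finset G) :
    subgroupRokhlinDim α τ = sInf {m : ℕ∞ | ∃ d : ℕ, m = d ∧ HasSubgroupTowers False α τ d} := by
  simp only [subgroupRokhlinDim, HasSubgroupRokhlinDimLE, HasSubgroupTowers, false_imp_iff,
    and_true]

lemma subgroupRokhlinDimC_eq (α : CStarPartialAction G A) (τ : Finset G) :
    subgroupRokhlinDimC α τ = sInf {m : ℕ∞ | ∃ d : ℕ, m = d ∧ HasSubgroupTowers True α τ d} := by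
  simp only [subgroupRokhlinDimC, HasSubgroupRokhlinDimCLE, HasSubgroupTowers, true_imp_iff]

lemma idealRokhlinDim_eq (α : CStarPartialAction G A) (I : Set A) :
    idealRokhlinDim α I = sInf {m : ℕ∞ | ∃ d : ℕ, m = d ∧ HasTowers False α I d} := by
  simp only [idealRokhlinDim, HasIdealRokhlinDimLE, HasTowers, false_imp_iff, and_true]

lemma idealRokhlinDimC_eq (α : CStarPartialAction G A) (I : Set A) :
    idealRokhlinDimC α I = sInf {m : ℕ∞ | ∃ d : ℕ, m = d ∧ HasTowers True α I d} := by
  simp only [idealRokhlinDimC, HasIdealRokhlinDimCLE, HasTowers, true_imp_iff]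

lemma rokhlinDim_eq (α : CStarPartialAction G A) :
    rokhlinDim α = sInf {m : ℕ∞ | ∃ d : ℕ, m = d ∧ HasTowers False α Set.univ d} := by
  simp only [rokhlinDim, HasRokhlinDimLE, HasTowers, false_imp_iff, and_true, Set.subset_univ,
    true_imp_iff, Set.mem_univ, implies_true]

lemma rokhlinDimC_eq (α : CStarPartialAction G A) :
    rokhlinDimC α = sInf {m : ℕ∞ | ∃ d : ℕ, m = d ∧ HasTowers True α Set.univ d} := by
  simp only [rokhlinDimC, HasRokhlinDimCLE, HasTowers, and_true, Set.subset_univ,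
    true_imp_iff, Set.mem_univ, implies_true]

end Comparison

/-- For a partial action `α` of a finite group `G` on a C*-algebra `A`
with the `n`-decomposition property, and `τ ∈ T_n(G)`:
`dim_Rok(α|_{H_τ}) = dim_Rok(α|_{A_{G·τ}})` and likewise for commuting towers;
consequently `dim_Rok(α) = max_{τ ∈ T_n(G)} dim_Rok(α|_{H_τ})` and likewise for
commuting towers. -/
theorem rokhlinDim_of_decomposable (α : CStarPartialAction G A) (n : ℕ)
    (hn1 : 1 ≤ n) (hn : n ≤ Fintype.card G) (hdec : NDecomposition α n)
    (τ : Finset G) (hτ : τ ∈ nTuples G n) :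
    (subgroupRokhlinDim α τ = idealRokhlinDim α (orbitIdeal α τ) ∧
      subgroupRokhlinDimC α τ = idealRokhlinDimC α (orbitIdeal α τ)) ∧
    ((rokhlinDim α = ⨆ τ' ∈ nTuples G n, subgroupRokhlinDim α τ') ∧
      (rokhlinDimC α = ⨆ τ' ∈ nTuples G n, subgroupRokhlinDimC α τ')) := by
  simp only [subgroupRokhlinDim_eq, subgroupRokhlinDimC_eq, idealRokhlinDim_eq,
    idealRokhlinDimC_eq, rokhlinDim_eq, rokhlinDimC_eq]
  refine ⟨⟨?_, ?_⟩, ?_, ?_⟩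
  · simp only [hasSubgroupTowers_iff hdec hτ]
  · simp only [hasSubgroupTowers_iff hdec hτ]
  · exact sInf_eq_iSup_sInf (fun _ _ _ _ hd => HasSubgroupTowers.mono hd)
      fun _ => hasTowers_univ_iff hdec False
  · exact sInf_eq_iSup_sInf (fun _ _ _ _ hd => HasSubgroupTowers.mono hd)
      fun _ => hasTowers_univ_iff hdec True

end Stmt7
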